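/- arXiv:math/0610431 — 7 statements merged into one kernel-verified Lean document; each statement's English description precedes it below -/
import Mathlib

section
/- Let N ≥ 3, 0 < a < 1, let p : ℝ^N → (0,∞) be Hölder continuous of exponent γ ∈ (0,1), let g satisfy (g1) and let f satisfy (f1)–(f2). If φ(r) := max_{|x|=r} p(x) satisfies ∫_1^∞ t φ(t) dt < ∞, then there exists v ∈ C²(ℝ^N) with v > 0 in ℝ^N, v(x) → 0 as |x| → ∞, and −Δv ≥ p(x)(g(v) + f(v) + |∇v|^a) in ℝ^N. -/
open Filter Set MeasureTheory Bornology

/-- The Laplace operator on `ℝ^N`, as the sum of the second partial derivatives. -/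
noncomputable def laplacianFn {N : ℕ} (u : EuclideanSpace ℝ (Fin N) → ℝ)
    (x : EuclideanSpace ℝ (Fin N)) : ℝ :=
  ∑ i, fderiv ℝ (fun y => fderiv ℝ u y (EuclideanSpace.single i 1)) x (EuclideanSpace.single i 1)

lemma hasFDerivAt_comp_one_add_norm_sq {E : Type*} [NormedAddCommGroup E] [InnerProductSpace ℝ E]
    {H : ℝ → ℝ} {d : ℝ} {x : E} (hH : HasDerivAt H d (1 + ‖x‖ ^ 2)) :
    HasFDerivAt (fun y : E => H (1 + ‖y‖ ^ 2)) ((2 * d) • innerSL ℝ x) x := by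
  have hn : HasFDerivAt (fun y : E => 1 + ‖y‖ ^ 2) (2 • innerSL ℝ x) x :=
    (hasStrictFDerivAt_norm_sq x).hasFDerivAt.const_add 1
  refine (hH.comp_hasFDerivAt x hn).congr_fderiv ?_
  ext y
  simp
  ring

lemma gradient_comp_one_add_norm_sq {E : Type*} [NormedAddCommGroup E] [InnerProductSpace ℝ E]
    [CompleteSpace E] {H : ℝ → ℝ} {d : ℝ} {x : E} (hH : HasDerivAt H d (1 + ‖x‖ ^ 2)) :
    gradient (fun y : E => H (1 + ‖y‖ ^ 2)) x = (2 * d) • x := by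
  apply HasGradientAt.gradient
  rw [hasGradientAt_iff_hasFDerivAt]
  have h : (InnerProductSpace.toDual ℝ E) ((2 * d) • x) = (2 * d) • innerSL ℝ x := by
    ext y
    simp
  rw [h]
  exact hasFDerivAt_comp_one_add_norm_sq hH

lemma laplacianFn_comp_one_add_norm_sq {N : ℕ} {H H₁ H₂ : ℝ → ℝ}
    (hH : ∀ s > 0, HasDerivAt H (H₁ s) s) (hH₁ : ∀ s > 0, HasDerivAt H₁ (H₂ s) s)
    (x : EuclideanSpace ℝ (Fin N)) :
    laplacianFn (fun y => H (1 + ‖y‖ ^ 2)) x =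
      4 * ‖x‖ ^ 2 * H₂ (1 + ‖x‖ ^ 2) + 2 * N * H₁ (1 + ‖x‖ ^ 2) := by
  have hfst (i : Fin N) (y : EuclideanSpace ℝ (Fin N)) :
      fderiv ℝ (fun y => H (1 + ‖y‖ ^ 2)) y (EuclideanSpace.single i 1) =
        2 * H₁ (1 + ‖y‖ ^ 2) * y i := by
    rw [(hasFDerivAt_comp_one_add_norm_sq (hH (1 + ‖y‖ ^ 2) (by positivity))).fderiv]
    simp [EuclideanSpace.inner_single_right]
  have hsnd (i : Fin N) :
      fderiv ℝ (fun y : EuclideanSpace ℝ (Fin N) => 2 * H₁ (1 + ‖y‖ ^ 2) * y i) x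
        (EuclideanSpace.single i 1) =
        4 * H₂ (1 + ‖x‖ ^ 2) * x i ^ 2 + 2 * H₁ (1 + ‖x‖ ^ 2) := by
    have h1 := (hasFDerivAt_comp_one_add_norm_sq (hH₁ (1 + ‖x‖ ^ 2) (by positivity))).const_mul 2
    have h2 : HasFDerivAt (fun y : EuclideanSpace ℝ (Fin N) => y i)
        (EuclideanSpace.proj (𝕜 := ℝ) i) x := (EuclideanSpace.proj (𝕜 := ℝ) i).hasFDerivAt
    have h3 : HasFDerivAt (fun y : EuclideanSpace ℝ (Fin N) => 2 * H₁ (1 + ‖y‖ ^ 2) * y i) _ x :=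
      h1.mul h2
    rw [h3.fderiv]
    simp [EuclideanSpace.inner_single_right]
    ring
  simp only [laplacianFn, hfst, hsnd]
  rw [Finset.sum_add_distrib, ← Finset.mul_sum, ← EuclideanSpace.real_norm_sq_eq]
  simp
  ring

lemma continuous_sphere_max {E : Type*} [NormedAddCommGroup E] [NormedSpace ℝ E] [ProperSpace E]
    {p : E → ℝ} (hp : Continuous p) {φ : ℝ → ℝ}
    (hφ : ∀ r ≥ (0 : ℝ), IsGreatest (p '' {x | ‖x‖ = r}) (φ r)) :
    Continuous fun r => φ |r| := by
  have hsup (r : ℝ) : φ |r| = sSup ((fun e => p (r • e)) '' Metric.sphere 0 1) := by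
    rw [← (hφ |r| (abs_nonneg r)).csSup_eq]
    obtain ⟨x₁, hx₁, -⟩ := (hφ 1 zero_le_one).1
    congr 1
    ext c
    constructor
    · rintro ⟨x, hx, rfl⟩
      rcases eq_or_ne r 0 with rfl | hr
      · refine ⟨x₁, by simpa using hx₁, ?_⟩
        simp_all
      · refine ⟨r⁻¹ • x, ?_, by simp [hr]⟩
        have : ‖x‖ = |r| := hx
        simp [norm_smul, this, hr]
    · rintro ⟨e, he, rfl⟩
      refine ⟨r • e, ?_, rfl⟩
      simp_all [norm_smul]
  simp only [hsup]
  exact (isCompact_sphere (0 : E) 1).continuous_sSup (f := fun (r : ℝ) e => p (r • e))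
    (by simp only [Function.HasUncurry.uncurry]; fun_prop)

lemma exists_decaying_radial_profile {ψ : ℝ → ℝ} (hψ : Continuous ψ) (hψ0 : ∀ s, 0 < ψ s) {T : ℝ}
    (hT : ∀ s ≥ 0, ∫ t in (0 : ℝ)..s, ψ t ≤ T) :
    ∃ w u u' : ℝ → ℝ, (∀ s > 0, HasDerivAt w (-u s) s) ∧ (∀ s > 0, HasDerivAt u (u' s) s) ∧
      ContinuousOn u' (Ioi 0) ∧ (∀ s > 0, 0 < u s) ∧ (∀ s > 0, 0 < w s) ∧
      Tendsto w atTop (nhds 0) ∧ (∀ s ≥ 1, w s ≤ w 1) ∧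
      (∃ D, 0 ≤ D ∧ ∀ s ≥ 1, 2 * √(s - 1) * u s ≤ D) ∧
      ∀ s ≥ 1, ψ s ≤ 4 * (s - 1) * u' s + 6 * u s := by
  obtain ⟨m, -, hm⟩ := isCompact_Icc.exists_isMaxOn (nonempty_Icc.2 (one_le_two (α := ℝ)))
    hψ.continuousOn
  set K := ψ m
  have hK : 0 < K := hψ0 m
  let J : ℝ → ℝ := fun s => ∫ t in (0 : ℝ)..s, ψ t
  let I : ℝ → ℝ := fun s => K + ∫ t in (0 : ℝ)..s, √t * ψ t / 2
  have hJ' (s : ℝ) : HasDerivAt J (ψ s) s := hψ.integral_hasStrictDerivAt 0 s |>.hasDerivAt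
  have hIc : Continuous fun t => √t * ψ t / 2 := by fun_prop
  have hI' (s : ℝ) : HasDerivAt I (√s * ψ s / 2) s :=
    (hIc.integral_hasStrictDerivAt 0 s).hasDerivAt.const_add K
  have hIcont : Continuous I := continuous_iff_continuousAt.2 fun s => (hI' s).continuousAt
  have hIK (s : ℝ) (hs : 0 < s) : K ≤ I s := by
    have : 0 ≤ ∫ t in (0 : ℝ)..s, √t * ψ t / 2 :=
      intervalIntegral.integral_nonneg hs.le fun t _ => by have := hψ0 t; positivity
    simp only [I]; linarith
  have hIT (s : ℝ) (hs : 1 ≤ s) : I s ≤ s * (K + T / 2) := by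
    have h1 : ∫ t in (0 : ℝ)..s, √t * ψ t / 2 ≤ ∫ t in (0 : ℝ)..s, √s / 2 * ψ t := by
      apply intervalIntegral.integral_mono_on (by linarith) (hIc.intervalIntegrable _ _)
        ((hψ.const_mul _).intervalIntegrable _ _)
      intro t ht
      have := Real.sqrt_le_sqrt ht.2
      nlinarith [hψ0 t]
    rw [intervalIntegral.integral_const_mul] at h1
    have h2 := hT s (by linarith)
    have h3 : √s ≤ s := Real.sqrt_le_iff.2 ⟨by linarith, by nlinarith⟩
    have h4 : 0 ≤ ∫ t in (0 : ℝ)..s, ψ t :=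
      intervalIntegral.integral_nonneg (by linarith) fun t _ => (hψ0 t).le
    have h5 : √s / 2 * ∫ t in (0 : ℝ)..s, ψ t ≤ s / 2 * T := by gcongr
    simp only [I]
    nlinarith
  let W : ℝ → ℝ := fun s => 2 * I s / √s - J s
  let u : ℝ → ℝ := fun s => I s / (s * √s)
  let u' : ℝ → ℝ := fun s => (ψ s / 2 - 3 / 2 * u s) / s
  have hu0 (s : ℝ) (hs : 0 < s) : 0 < u s := by
    have := hIK s hs
    have : 0 < I s := by linarith
    positivity
  have hu' (s : ℝ) (hs : 0 < s) : HasDerivAt u (u' s) s := by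
    have hr : 0 < √s := Real.sqrt_pos.2 hs
    refine ((hI' s).fun_div ((hasDerivAt_id s).fun_mul (Real.hasDerivAt_sqrt hs.ne'))
      (mul_pos hs hr).ne').congr_deriv ?_
    have hsq : s = √s ^ 2 := (Real.sq_sqrt hs.le).symm
    simp only [u', u, id]
    generalize √s = r at *
    subst hsq
    field_simp
    ring
  have hW' (s : ℝ) (hs : 0 < s) : HasDerivAt W (-u s) s := by
    have hr : 0 < √s := Real.sqrt_pos.2 hs
    refine ((((hI' s).const_mul 2).fun_div (Real.hasDerivAt_sqrt hs.ne') hr.ne').fun_sub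
      (hJ' s)).congr_deriv ?_
    have hsq : s = √s ^ 2 := (Real.sq_sqrt hs.le).symm
    simp only [u]
    generalize √s = r at *
    subst hsq
    field_simp
    ring
  have hWanti : StrictAntiOn W (Ioi 0) := by
    apply strictAntiOn_of_deriv_neg (convex_Ioi 0)
    · exact fun s hs => (hW' s hs).continuousAt.continuousWithinAt
    · intro s hs
      rw [interior_Ioi] at hs
      rw [(hW' s hs).deriv]
      exact neg_neg_of_pos (hu0 s hs)
  have hWT (s : ℝ) (hs : 0 < s) : -T ≤ W s := by
    have := hT s hs.le
    have := hIK s hs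
    have : 0 < I s := by linarith
    have : 0 ≤ 2 * I s / √s := by positivity
    simp only [W, J]
    linarith
  have hmax (s : ℝ) : 0 < max s 1 := by positivity
  have hanti : Antitone fun s => W (max s 1) := fun s t hst =>
    hWanti.antitoneOn (hmax s) (hmax t) (max_le_max_right 1 hst)
  have hbdd : BddBelow (range fun s => W (max s 1)) := ⟨-T, by
    rintro _ ⟨s, rfl⟩
    exact hWT _ (hmax s)⟩
  have hlim := tendsto_atTop_ciInf hanti hbdd
  set L := ⨅ s, W (max s 1)
  refine ⟨fun s => W s - L, u, u', fun s hs => (hW' s hs).sub_const L, hu', ?_, hu0, ?_, ?_, ?_,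
    ⟨2 * K + T, ?_, ?_⟩, ?_⟩
  · have : ContinuousOn u (Ioi 0) := fun s hs => (hu' s hs).continuousAt.continuousWithinAt
    exact ((hψ.continuousOn.div_const 2).sub (this.const_mul _)).div continuousOn_id
      fun s hs => ne_of_gt hs
  · intro s hs
    have h1 : L ≤ W (max (s + 1) 1) := ciInf_le hbdd (s + 1)
    have h2 : W (max (s + 1) 1) < W s := by
      rw [max_eq_left (by linarith)]
      exact hWanti hs (by simp; linarith) (by linarith)
    linarith
  · rw [← sub_self L]
    refine (hlim.sub_const L).congr' ?_
    filter_upwards [eventually_ge_atTop 1] with s hs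
    rw [max_eq_left hs]
  · intro s hs
    have := hWanti.antitoneOn (a := 1) (b := s) (by simp) (by simp; linarith) hs
    simpa
  · have := hT 0 le_rfl
    simp at this
    linarith
  · intro s hs
    have h1 := hIT s hs
    have h2 : √(s - 1) ≤ √s := Real.sqrt_le_sqrt (by linarith)
    have hr : 0 < √s := Real.sqrt_pos.2 (by linarith)
    calc 2 * √(s - 1) * u s ≤ 2 * √s * u s := by
          have := hu0 s (by linarith)
          gcongr
      _ = 2 * I s / s := by simp only [u]; field_simp
      _ ≤ 2 * K + T := by
          rw [div_le_iff₀ (by linarith)]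
          linarith
  · intro s hs
    have hs0 : 0 < s := by linarith
    have hu := hu0 s hs0
    have key : 4 * (s - 1) * u' s + 6 * u s = 2 * (1 - 1 / s) * ψ s + 6 * u s / s := by
      simp only [u']
      field_simp
      ring
    rw [key]
    rcases le_total s 2 with h2 | h2
    · have h1 : ψ s ≤ K := hm ⟨hs, h2⟩
      have h3 : K ≤ 6 * u s / s := by
        have hr : 0 < √s := Real.sqrt_pos.2 hs0
        have hr2 : √s ≤ 3 / 2 := Real.sqrt_le_iff.2 ⟨by norm_num, by linarith⟩
        have h6 : s * √s * s ≤ 6 := by nlinarith [mul_le_mul h2 h2 hs0.le zero_le_two]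
        simp only [u]
        rw [le_div_iff₀ hs0, mul_div_assoc', le_div_iff₀ (by positivity)]
        have := hIK s hs0
        nlinarith
      have h4 : 0 ≤ 2 * (1 - 1 / s) * ψ s := by
        have : 1 / s ≤ 1 := by rw [div_le_one hs0]; exact hs
        have := hψ0 s
        have : 0 ≤ 1 - 1 / s := by linarith
        positivity
      linarith
    · have h1 : 1 / s ≤ 1 / 2 := one_div_le_one_div_of_le two_pos h2
      have h3 : 0 ≤ 6 * u s / s := by positivity
      nlinarith [hψ0 s]

lemma exists_ode_solution_of_tendsto_atTop {G : ℝ → ℝ} (hGc : ContinuousOn G (Ioi 0))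
    (hG1 : ∀ t > 0, 1 ≤ G t) (hGa : AntitoneOn G (Ioi 0))
    (hG0 : Tendsto G (nhdsWithin 0 (Ioi 0)) atTop) :
    ∃ h : ℝ → ℝ, Continuous h ∧ h 0 = 0 ∧ (∀ y > 0, 0 < h y) ∧
      (∀ y > 0, HasDerivAt h (G (h y)) y) ∧ ∀ y > 0, h y ≤ 1 + G 1 * y := by
  let q : ℝ → ℝ := Function.update (fun s => (G |s|)⁻¹) 0 0
  have hq (s : ℝ) (hs : s ≠ 0) : q s = (G |s|)⁻¹ := Function.update_of_ne hs _ _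
  have hqpos (s : ℝ) (hs : s ≠ 0) : 0 < q s := by
    rw [hq s hs]
    have := hG1 |s| (by positivity)
    positivity
  have hqc : Continuous q := by
    rw [continuous_iff_continuousAt]
    intro s
    rcases eq_or_ne s 0 with rfl | hs
    · exact continuousAt_update_same.2
        ((tendsto_inv_atTop_zero.comp hG0).comp tendsto_abs_nhdsNE_zero)
    · have hs' : 0 < |s| := by positivity
      refine (continuousAt_update_of_ne hs).2 (ContinuousAt.inv₀ ?_ ?_)
      · exact ContinuousAt.comp (f := fun s : ℝ => |s|) (hGc.continuousAt (Ioi_mem_nhds hs'))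
          continuous_abs.continuousAt
      · have := hG1 |s| hs'
        positivity
  have hqneg (s : ℝ) : q (-s) = q s := by
    rcases eq_or_ne s 0 with rfl | hs
    · simp
    · rw [hq s hs, hq (-s) (neg_ne_zero.2 hs), abs_neg]
  let Φ : ℝ → ℝ := fun t => ∫ s in (0 : ℝ)..t, q s
  have hΦ' (t : ℝ) : HasDerivAt Φ (q t) t := (hqc.integral_hasStrictDerivAt 0 t).hasDerivAt
  have hΦc : Continuous Φ := continuous_iff_continuousAt.2 fun t => (hΦ' t).continuousAt
  have hΦ0 : Φ 0 = 0 := intervalIntegral.integral_same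
  have hΦneg (t : ℝ) : Φ (-t) = -Φ t := by
    have := intervalIntegral.integral_comp_neg (a := 0) (b := t) q
    simp only [hqneg, neg_zero] at this
    simp only [Φ]
    rw [this, intervalIntegral.integral_symm]
  have hΦmono : StrictMono Φ := by
    have h1 : StrictMonoOn Φ (Ici 0) := by
      apply strictMonoOn_of_deriv_pos (convex_Ici 0) hΦc.continuousOn
      intro t ht
      rw [interior_Ici] at ht
      rw [(hΦ' t).deriv]
      exact hqpos t (ne_of_gt ht)
    have h2 : StrictMonoOn Φ (Iic 0) := by
      apply strictMonoOn_of_deriv_pos (convex_Iic 0) hΦc.continuousOn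
      intro t ht
      rw [interior_Iic] at ht
      rw [(hΦ' t).deriv]
      exact hqpos t (ne_of_lt ht)
    exact h2.Iic_union_Ici h1
  have hG1pos : 0 < G 1 := zero_lt_one.trans_le (hG1 1 one_pos)
  have hΦlb (t : ℝ) (ht : 1 ≤ t) : (t - 1) / G 1 ≤ Φ t := by
    have h1 : 0 < Φ 1 := hΦ0 ▸ hΦmono one_pos
    have h2 : ∫ s in (1 : ℝ)..t, (G 1)⁻¹ ≤ ∫ s in (1 : ℝ)..t, q s := by
      apply intervalIntegral.integral_mono_on ht (by simp) (hqc.intervalIntegrable _ _)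
      intro s hs
      have hs0 : 0 < s := by linarith [hs.1]
      rw [hq s hs0.ne', abs_of_pos hs0]
      have := hG1 s hs0
      exact inv_anti₀ (by linarith) (hGa (mem_Ioi.2 one_pos) hs0 hs.1)
    have h3 : Φ 1 + ∫ s in (1 : ℝ)..t, q s = Φ t :=
      intervalIntegral.integral_add_adjacent_intervals (hqc.intervalIntegrable _ _)
        (hqc.intervalIntegrable _ _)
    rw [intervalIntegral.integral_const, smul_eq_mul, ← div_eq_mul_inv] at h2
    linarith
  have htop : Tendsto Φ atTop atTop := by
    apply tendsto_atTop_mono' atTop (f₁ := fun t => (t - 1) / G 1)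
    · filter_upwards [eventually_ge_atTop 1] with t ht using hΦlb t ht
    · exact (tendsto_atTop_add_const_right atTop (-1) tendsto_id).atTop_div_const hG1pos
  have hbot : Tendsto Φ atBot atBot := by
    have := tendsto_neg_atTop_atBot.comp (htop.comp tendsto_neg_atBot_atTop)
    refine this.congr fun t => ?_
    simp [hΦneg]
  let e : ℝ ≃o ℝ := hΦmono.orderIsoOfSurjective Φ (hΦc.surjective htop hbot)
  have he (y : ℝ) : Φ (e.symm y) = y := e.apply_symm_apply y
  have he0 : e.symm 0 = 0 := by rw [OrderIso.symm_apply_eq]; exact hΦ0.symm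
  have hpos (y : ℝ) (hy : 0 < y) : 0 < e.symm y := he0 ▸ e.symm.strictMono hy
  refine ⟨e.symm, e.symm.continuous, he0, hpos, fun y hy => ?_, fun y hy => ?_⟩
  · have h1 := hpos y hy
    have := (hΦ' (e.symm y)).of_local_left_inverse e.symm.continuous.continuousAt
      (hqpos _ h1.ne').ne' (Eventually.of_forall he)
    rwa [hq _ h1.ne', inv_inv, abs_of_pos h1] at this
  · rcases le_total (e.symm y) 1 with h | h
    · have : 0 < G 1 * y := by positivity
      linarith
    · have := hΦlb _ h
      rw [he, div_le_iff₀ hG1pos] at this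
      linarith

lemma contDiffOn_two_of_hasDerivAt {H H₁ H₂ : ℝ → ℝ} {S : Set ℝ} (hS : IsOpen S)
    (hH : ∀ s ∈ S, HasDerivAt H (H₁ s) s) (hH₁ : ∀ s ∈ S, HasDerivAt H₁ (H₂ s) s)
    (hH₂ : ContinuousOn H₂ S) : ContDiffOn ℝ 2 H S := by
  have aux {n : ℕ} {F F' : ℝ → ℝ} (hF : ∀ s ∈ S, HasDerivAt F (F' s) s)
      (hF' : ContDiffOn ℝ n F' S) : ContDiffOn ℝ (n + 1) F S := by
    rw [contDiffOn_succ_iff_deriv_of_isOpen hS]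
    exact ⟨fun s hs => (hF s hs).differentiableAt.differentiableWithinAt, by simp,
      hF'.congr fun s hs => (hF s hs).deriv⟩
  have h0 : ContDiffOn ℝ (0 : ℕ) H₂ S := contDiffOn_zero.2 hH₂
  have h1 : ContDiffOn ℝ (1 : ℕ) H₁ S := by simpa using aux hH₁ h0
  simpa [one_add_one_eq_two] using aux hH h1

lemma integral_comp_sqrt_sub_one_le {φ : ℝ → ℝ} (hφc : Continuous fun r => φ |r|)
    (hφ0 : ∀ r ≥ 0, 0 < φ r) (hφi : IntegrableOn (fun t => t * φ t) (Ioi 1)) (s : ℝ) :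
    ∫ t in (0 : ℝ)..s, φ √(t - 1) ≤
      (∫ t in (0 : ℝ)..1, φ √(t - 1)) + 2 * ∫ t in Ioi (0 : ℝ), t * φ t := by
  have hψ : Continuous fun t => φ √(t - 1) := by
    have := hφc.comp (f := fun t : ℝ => √(t - 1)) (by fun_prop)
    simpa [Function.comp_def, abs_of_nonneg (Real.sqrt_nonneg _)] using this
  have hi0 : IntegrableOn (fun t => t * φ t) (Ioi 0) := by
    have h1 : IntegrableOn (fun t => t * φ t) (Ioc 0 1) := by
      have : IntegrableOn (fun t => t * φ |t|) (Ioc 0 1) :=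
        (continuous_id.mul hφc).integrableOn_Ioc
      refine this.congr_fun (fun t ht => ?_) measurableSet_Ioc
      simp only [abs_of_pos ht.1]
    rw [← Ioc_union_Ioi_eq_Ioi (zero_le_one (α := ℝ))]
    exact h1.union hφi
  have hnn : ∀ t ∈ Ioi (0 : ℝ), 0 ≤ t * φ t := fun t ht =>
    mul_nonneg (le_of_lt ht) (hφ0 t (le_of_lt ht)).le
  have hI : 0 ≤ ∫ t in Ioi (0 : ℝ), t * φ t := setIntegral_nonneg measurableSet_Ioi hnn
  have hadd : (∫ t in (0 : ℝ)..1, φ √(t - 1)) + ∫ t in (1 : ℝ)..s, φ √(t - 1) =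
      ∫ t in (0 : ℝ)..s, φ √(t - 1) :=
    intervalIntegral.integral_add_adjacent_intervals (hψ.intervalIntegrable _ _)
      (hψ.intervalIntegrable _ _)
  rw [← hadd]
  gcongr
  rcases le_total s 1 with h1 | h1
  · rw [intervalIntegral.integral_symm]
    have : 0 ≤ ∫ t in s..1, φ √(t - 1) :=
      intervalIntegral.integral_nonneg h1 fun t _ => (hφ0 _ (Real.sqrt_nonneg _)).le
    linarith
  · have hsub := intervalIntegral.integral_comp_mul_deriv (a := 0) (b := √(s - 1))
      (f := fun t => 1 + t ^ 2) (f' := fun t => 2 * t) (g := fun t => φ √(t - 1))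
      (fun t _ => by simpa using ((hasDerivAt_id t).fun_pow 2).const_add 1) (by fun_prop) hψ
    rw [Real.sq_sqrt (by linarith)] at hsub
    simp only [ne_eq, OfNat.ofNat_ne_zero, not_false_eq_true, zero_pow, add_zero,
      add_sub_cancel, Function.comp_apply, add_sub_cancel_left, Real.sqrt_sq_eq_abs] at hsub
    rw [← hsub, intervalIntegral.integral_of_le (Real.sqrt_nonneg _),
      ← integral_const_mul]
    have heq : ∫ t in Ioc 0 √(s - 1), φ |t| * (2 * t) =
        ∫ t in Ioc 0 √(s - 1), 2 * (t * φ t) := by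
      refine setIntegral_congr_fun measurableSet_Ioc fun t ht => ?_
      simp only [abs_of_pos ht.1]
      ring
    rw [heq]
    refine setIntegral_mono_set (hi0.const_mul 2) ?_ Ioc_subset_Ioi_self.eventuallyLE
    filter_upwards [ae_restrict_mem measurableSet_Ioi] with t ht
    have := hnn t ht
    simp only [Pi.zero_apply]
    linarith

lemma exists_const_dominating_sublinear {a D M : ℝ} (ha0 : 0 < a) (ha1 : a < 1) (hD : 0 ≤ D) (hM : 0 < M)
    {f : ℝ → ℝ} (hf : Tendsto (fun t => f t / t) atTop (nhds 0)) :
    ∃ C : ℝ, 3 ≤ C ∧ (C * D) ^ a ≤ C / 3 ∧ f (1 + M * C) ≤ C / 3 := by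
  have h1 : Tendsto (fun C : ℝ => C ^ (-(1 - a)) * D ^ a) atTop (nhds 0) := by
    simpa using (tendsto_rpow_neg_atTop (sub_pos.2 ha1)).mul_const (D ^ a)
  have hlin : Tendsto (fun C : ℝ => 1 + M * C) atTop atTop :=
    tendsto_atTop_add_const_left _ 1 (tendsto_id.const_mul_atTop hM)
  have h2 := (hf.comp hlin).eventually_le_const (show (0 : ℝ) < 1 / (3 * (1 + M)) by positivity)
  obtain ⟨C, hC3, hC1, hC2⟩ := ((eventually_ge_atTop 3).and
    ((h1.eventually_le_const (show (0 : ℝ) < 1 / 3 by norm_num)).and h2)).exists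
  have hC : 0 < C := by linarith
  refine ⟨C, hC3, ?_, ?_⟩
  · have : (C * D) ^ a = C * (C ^ (-(1 - a)) * D ^ a) := by
      rw [Real.mul_rpow hC.le hD, ← mul_assoc]
      congr 1
      rw [← Real.rpow_one_add' hC.le (by linarith)]
      ring_nf
    rw [this]
    nlinarith
  · simp only [Function.comp_apply] at hC2
    rw [div_le_iff₀ (by positivity)] at hC2
    refine hC2.trans ?_
    rw [div_mul_eq_mul_div, div_le_div_iff₀ (by positivity) (by norm_num)]
    nlinarith

/-- existence of a supersolution of
the problem: `v ∈ C²(ℝ^N)` with `v > 0`, `v(x) → 0` as `|x| → ∞` and `-Δv ≥ p(x)(g(v) + f(v) + |∇v|^a)` in `ℝ^N`. -/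
theorem supersolution_existence
    {N : ℕ} (hN : 3 ≤ N) (a γ : ℝ) (ha0 : 0 < a) (ha1 : a < 1)
    (hγ0 : 0 < γ) (hγ1 : γ < 1)
    (p : EuclideanSpace ℝ (Fin N) → ℝ)
    (hp_pos : ∀ x, 0 < p x)
    (hp_holder : ∃ C : NNReal, HolderWith C (Real.toNNReal γ) p)
    (g : ℝ → ℝ)
    (hg_smooth : ContDiffOn ℝ 1 g (Ioi 0))
    (hg_pos : ∀ t > (0:ℝ), 0 < g t)
    (hg_dec : StrictAntiOn g (Ioi 0))
    (hg1 : Tendsto g (nhdsWithin 0 (Ioi 0)) atTop)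
    (f : ℝ → ℝ)
    (hf_nonneg : ∀ t ≥ (0:ℝ), 0 ≤ f t)
    (hf_holder : ∃ C : NNReal, HolderOnWith C (Real.toNNReal γ) f (Ici 0))
    (hf_mono : MonotoneOn f (Ici 0))
    (hf_pos : ∀ t > (0:ℝ), 0 < f t)
    (hf1 : AntitoneOn (fun t => f t / t) (Ioi 0))
    (hf2 : Tendsto (fun t => f t / t) (nhdsWithin 0 (Ioi 0)) atTop)
    (hf2' : Tendsto (fun t => f t / t) atTop (nhds 0))
    (φ : ℝ → ℝ)
    (hφ_max : ∀ r ≥ (0:ℝ), IsGreatest (p '' {x | ‖x‖ = r}) (φ r))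
    (hφ_int : IntegrableOn (fun t => t * φ t) (Ioi 1)) :
    ∃ v : EuclideanSpace ℝ (Fin N) → ℝ,
      ContDiff ℝ 2 v ∧
      (∀ x, 0 < v x) ∧
      Tendsto v (cocompact _) (nhds 0) ∧
      (∀ x, p x * (g (v x) + f (v x) + ‖gradient v x‖ ^ a) ≤ -laplacianFn v x) := by
  have hpc : Continuous p := by
    obtain ⟨_, hC⟩ := hp_holder
    exact hC.continuous (Real.toNNReal_pos.2 hγ0)
  have hφc := continuous_sphere_max hpc hφ_max
  have hφ0 : ∀ r ≥ 0, 0 < φ r := by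
    intro r hr
    obtain ⟨x, -, hx⟩ := (hφ_max r hr).1
    exact hx ▸ hp_pos x
  have hψc : Continuous fun s => φ √(s - 1) := by
    have := hφc.comp (f := fun s : ℝ => √(s - 1)) (by fun_prop)
    simpa [Function.comp_def, abs_of_nonneg (Real.sqrt_nonneg _)] using this
  obtain ⟨w, u, u', hw, hu, hu'c, hu0, hw0, hwlim, hw1, ⟨D, hD0, hD⟩, hψ⟩ :=
    exists_decaying_radial_profile hψc (fun s => hφ0 _ (Real.sqrt_nonneg _))
      (fun s _ => integral_comp_sqrt_sub_one_le hφc hφ0 hφ_int s)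
  let G : ℝ → ℝ := fun t => g t + 1
  have hG1 : ∀ t > 0, 1 ≤ G t := fun t ht => by have := hg_pos t ht; simp only [G]; linarith
  have hg' : ∀ t > 0, HasDerivAt g (deriv g t) t := fun t ht =>
    ((hg_smooth.differentiableOn one_ne_zero).differentiableAt (Ioi_mem_nhds ht)).hasDerivAt
  have hg'c : ContinuousOn (deriv g) (Ioi 0) :=
    hg_smooth.continuousOn_deriv_of_isOpen isOpen_Ioi le_rfl
  have hg'0 : ∀ t > 0, deriv g t ≤ 0 := fun t ht => by
    rw [← derivWithin_of_isOpen isOpen_Ioi ht]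
    exact hg_dec.antitoneOn.derivWithin_nonpos
  obtain ⟨h, hhc, hh0, hhpos, hh', hhle⟩ := exists_ode_solution_of_tendsto_atTop (G := G)
    (hg_smooth.continuousOn.add continuousOn_const) hG1
    (fun s hs t ht hst => by simpa [G] using hg_dec.antitoneOn hs ht hst)
    (tendsto_atTop_add_const_right _ 1 hg1)
  have hM : 0 < G 1 * w 1 := mul_pos (by linarith [hG1 1 one_pos]) (hw0 1 one_pos)
  obtain ⟨C, hC3, hCD, hCf⟩ := exists_const_dominating_sublinear ha0 ha1 hD0 hM hf2'
  have hC : 0 < C := by linarith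
  let H : ℝ → ℝ := fun s => h (C * w s)
  let H₁ : ℝ → ℝ := fun s => -(C * G (H s) * u s)
  let H₂ : ℝ → ℝ := fun s => -(C * (deriv g (H s) * H₁ s) * u s + C * G (H s) * u' s)
  have hH0 : ∀ s > 0, 0 < H s := fun s hs => hhpos _ (mul_pos hC (hw0 s hs))
  have hH : ∀ s > 0, HasDerivAt H (H₁ s) s := fun s hs =>
    ((hh' _ (mul_pos hC (hw0 s hs))).comp s ((hw s hs).const_mul C)).congr_deriv
      (by simp only [H₁, H]; ring)
  have hH₁ : ∀ s > 0, HasDerivAt H₁ (H₂ s) s := fun s hs =>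
    (((((hg' _ (hH0 s hs)).comp s (hH s hs)).add_const 1).const_mul C).fun_mul (hu s hs)).fun_neg
  have hHc : ContinuousOn H (Ioi 0) := fun s hs => (hH s hs).continuousAt.continuousWithinAt
  have hH₁c : ContinuousOn H₁ (Ioi 0) := fun s hs => (hH₁ s hs).continuousAt.continuousWithinAt
  have huc : ContinuousOn u (Ioi 0) := fun s hs => (hu s hs).continuousAt.continuousWithinAt
  have hH₂c : ContinuousOn H₂ (Ioi 0) := by
    have h1 : ContinuousOn (fun s => deriv g (H s)) (Ioi 0) := hg'c.comp hHc hH0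
    have h2 : ContinuousOn (fun s => G (H s)) (Ioi 0) :=
      (hg_smooth.continuousOn.comp hHc hH0).add continuousOn_const
    exact (((continuousOn_const.mul (h1.mul hH₁c)).mul huc).add
      ((continuousOn_const.mul h2).mul hu'c)).neg
  have hs0 (x : EuclideanSpace ℝ (Fin N)) : 0 < 1 + ‖x‖ ^ 2 := by positivity
  refine ⟨fun x => H (1 + ‖x‖ ^ 2), ?_, fun x => hH0 _ (hs0 x), ?_, fun x => ?_⟩
  · rw [← contDiffOn_univ]
    exact (contDiffOn_two_of_hasDerivAt isOpen_Ioi hH hH₁ hH₂c).comp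
      (contDiff_const.add (contDiff_norm_sq ℝ)).contDiffOn fun x _ => hs0 x
  · have h1 : Tendsto H atTop (nhds 0) := by
      have h2 : Tendsto (fun s => C * w s) atTop (nhds 0) := by simpa using hwlim.const_mul C
      have := (hhc.tendsto 0).comp h2
      rwa [hh0] at this
    refine h1.comp (tendsto_atTop_add_const_left _ 1 ?_)
    exact (tendsto_pow_atTop two_ne_zero).comp tendsto_norm_cocompact_atTop
  · rw [gradient_comp_one_add_norm_sq (hH _ (hs0 x)), laplacianFn_comp_one_add_norm_sq hH hH₁]
    have hsqrt : √(1 + ‖x‖ ^ 2 - 1) = ‖x‖ := by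
      rw [add_sub_cancel_left, Real.sqrt_sq (norm_nonneg x)]
    have hs : 1 ≤ 1 + ‖x‖ ^ 2 := by nlinarith [norm_nonneg x]
    have hDx := hD _ hs
    have hψx := hψ _ hs
    rw [hsqrt] at hDx hψx
    rw [add_sub_cancel_left] at hψx
    have hpφ : p x ≤ φ ‖x‖ := (hφ_max _ (norm_nonneg x)).2 ⟨x, rfl, rfl⟩
    have hw1x := hw1 _ hs
    set s := 1 + ‖x‖ ^ 2
    have hu0s := hu0 s (hs0 x)
    have hH0s := hH0 s (hs0 x)
    have hG1s := hG1 _ hH0s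
    have hdom : g (H s) + f (H s) + ‖(2 * H₁ s) • x‖ ^ a ≤ C * G (H s) := by
      have hf : f (H s) ≤ C / 3 := by
        refine (hf_mono hH0s.le (by simp; positivity) ?_).trans hCf
        refine (hhle _ (mul_pos hC (hw0 s (hs0 x)))).trans ?_
        have : G 1 * (C * w s) ≤ G 1 * (C * w 1) := by
          have := hG1 1 one_pos
          gcongr
        linarith
      have hgrad : ‖(2 * H₁ s) • x‖ ^ a ≤ C / 3 * G (H s) := by
        have h1 : ‖(2 * H₁ s) • x‖ ≤ C * D * G (H s) := by
          have h2 : |H₁ s| = C * G (H s) * u s := by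
            simp only [H₁]
            rw [abs_neg, abs_of_nonneg (by positivity)]
          rw [norm_smul, Real.norm_eq_abs, abs_mul, abs_two, h2]
          calc 2 * (C * G (H s) * u s) * ‖x‖ = C * G (H s) * (2 * ‖x‖ * u s) := by ring
            _ ≤ C * G (H s) * D := by gcongr
            _ = C * D * G (H s) := by ring
        calc ‖(2 * H₁ s) • x‖ ^ a ≤ (C * D * G (H s)) ^ a :=
              Real.rpow_le_rpow (norm_nonneg _) h1 ha0.le
          _ = (C * D) ^ a * G (H s) ^ a := Real.mul_rpow (by positivity) (by positivity)
          _ ≤ C / 3 * G (H s) := by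
              gcongr
              exact Real.rpow_le_self_of_one_le hG1s ha1.le
      have hgG : g (H s) = G (H s) - 1 := by simp [G]
      nlinarith
    have hN' : (3 : ℝ) ≤ N := by exact_mod_cast hN
    have hlap : C * G (H s) * φ ‖x‖ ≤ -(4 * ‖x‖ ^ 2 * H₂ s + 2 * N * H₁ s) := by
      have h1 : -(4 * ‖x‖ ^ 2 * H₂ s + 2 * N * H₁ s) =
          C * G (H s) * (4 * ‖x‖ ^ 2 * u' s + 2 * N * u s) +
            4 * ‖x‖ ^ 2 * (C ^ 2 * G (H s) * u s ^ 2) * -deriv g (H s) := by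
        simp only [H₂, H₁]
        ring
      have h2 : 0 ≤ 4 * ‖x‖ ^ 2 * (C ^ 2 * G (H s) * u s ^ 2) * -deriv g (H s) :=
        mul_nonneg (by positivity) (neg_nonneg.2 (hg'0 _ hH0s))
      have h3 : φ ‖x‖ ≤ 4 * ‖x‖ ^ 2 * u' s + 2 * N * u s := by nlinarith
      rw [h1]
      have : C * G (H s) * φ ‖x‖ ≤ C * G (H s) * (4 * ‖x‖ ^ 2 * u' s + 2 * N * u s) := by gcongr
      linarith
    calc p x * (g (H s) + f (H s) + ‖(2 * H₁ s) • x‖ ^ a) ≤ p x * (C * G (H s)) := by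
          gcongr
          exact (hp_pos x).le
      _ ≤ φ ‖x‖ * (C * G (H s)) := by gcongr
      _ = C * G (H s) * φ ‖x‖ := by ring
      _ ≤ _ := hlap
end

section
/- Let g : (0,∞) → (0,∞) be continuous and decreasing, let 0 < a < 1 and η > 0. Suppose h : [0,η] → [0,∞) is continuous, twice continuously differentiable on (0,η), satisfies h''(t) = −g(h(t)) for all 0 < t < η, h(0) = 0, h > 0 on (0,η], and h' > 0 on (0,η]. Then there exists a constant C > 0 such that (h'(t))^a ≤ C · g(h(t)) for all t ∈ (0,η). -/
open Filter Set MeasureTheory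

theorem Real.rpow_le_one_add_self {x a : ℝ} (hx : 0 ≤ x) (ha0 : 0 ≤ a) (ha1 : a ≤ 1) :
    x ^ a ≤ 1 + x := by
  rcases le_total x 1 with h | h
  · linarith [Real.rpow_le_one hx h ha0]
  · have := Real.rpow_le_rpow_of_exponent_le h ha1
    rw [Real.rpow_one] at this
    linarith

/-- gradient estimate for the ODE `h'' = -g(h)` with `g` decreasing:
there is `C > 0` with `(h'(t))^a ≤ C g(h(t))` for all `t ∈ (0,η)`. -/
theorem ode_gradient_estimate
    (g : ℝ → ℝ) (hg_cont : ContinuousOn g (Ioi 0)) (hg_pos : ∀ t > (0:ℝ), 0 < g t)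
    (hg_dec : StrictAntiOn g (Ioi 0))
    (a : ℝ) (ha0 : 0 < a) (ha1 : a < 1)
    (η : ℝ) (hη : 0 < η)
    (h h' : ℝ → ℝ)
    (h_cont : ContinuousOn h (Icc 0 η))
    (h_deriv : ∀ t ∈ Ioo 0 η, HasDerivAt h (h' t) t)
    (h_derivη : HasDerivWithinAt h (h' η) (Iic η) η)
    (h'_cont : ContinuousOn h' (Ioc 0 η))
    (h''_eq : ∀ t ∈ Ioo 0 η, HasDerivAt h' (-(g (h t))) t)
    (h_zero : h 0 = 0)
    (h_pos : ∀ t ∈ Ioc 0 η, 0 < h t)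
    (h'_pos : ∀ t ∈ Ioc 0 η, 0 < h' t) :
    ∃ C > (0:ℝ), ∀ t ∈ Ioo 0 η, (h' t) ^ a ≤ C * g (h t) := by
  have h_mono : StrictMonoOn h (Icc 0 η) := by
    refine strictMonoOn_of_deriv_pos (convex_Icc 0 η) h_cont fun t ht => ?_
    rw [interior_Icc] at ht
    rw [(h_deriv t ht).deriv]
    exact h'_pos t ⟨ht.1, ht.2.le⟩
  have hη_mem : η ∈ Ioc 0 η := ⟨hη, le_rfl⟩
  have g_anti : ∀ s ∈ Ioc 0 η, ∀ t ∈ Ioc 0 η, s ≤ t → g (h t) ≤ g (h s) := fun s hs t ht hst =>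
    hg_dec.antitoneOn (h_pos s hs) (h_pos t ht)
      (h_mono.monotoneOn ⟨hs.1.le, hs.2⟩ ⟨ht.1.le, ht.2⟩ hst)
  have hm := hg_pos _ (h_pos η hη_mem)
  have hp := h'_pos η hη_mem
  refine ⟨(1 + h' η) / g (h η) + η, by positivity, fun t ht => ?_⟩
  have ht' : t ∈ Ioc 0 η := ⟨ht.1, ht.2.le⟩
  obtain ⟨c, hc, hc_eq⟩ := exists_hasDerivAt_eq_slope h' (fun s => -(g (h s))) ht.2
    (h'_cont.mono fun s hs => ⟨ht.1.trans_le hs.1, hs.2⟩)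
    (fun s hs => h''_eq s ⟨ht.1.trans hs.1, hs.2⟩)
  rw [eq_div_iff (sub_pos.2 ht.2).ne'] at hc_eq
  have hgc := g_anti t ht' c ⟨ht.1.trans hc.1, hc.2.le⟩ hc.1.le
  have hgt := hg_pos _ (h_pos t ht')
  have h_slope : h' t ≤ h' η + η * g (h t) := by
    have h₁ := mul_le_mul_of_nonneg_right hgc (sub_pos.2 ht.2).le
    have h₂ := mul_pos hgt ht.1
    linarith
  have h_const : 1 + h' η ≤ (1 + h' η) / g (h η) * g (h t) := by
    rw [div_mul_eq_mul_div, le_div_iff₀ hm]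
    exact mul_le_mul_of_nonneg_left (g_anti t ht' η hη_mem ht.2.le) (by positivity)
  have h_rpow := Real.rpow_le_one_add_self (h'_pos t ht').le ha0.le ha1.le
  linarith
end

section
/- Let Ω ⊂ ℝ^N be a bounded domain, 0 < a < 1, let p : Ω̄ → (0,∞) be continuous, and let F : (0,∞) → (0,∞) be such that the map t ↦ F(t)/t is decreasing on (0,∞). Suppose u ∈ C²(Ω) ∩ C(Ω̄) satisfies −Δu = p(x)(F(u) + |∇u|^a) in Ω, u > 0 in Ω and u = 0 on ∂Ω, and suppose v ∈ C²(Ω) ∩ C(Ω̄) satisfies −Δv ≥ p(x)(F(v) + |∇v|^a) in Ω with v > 0 on Ω̄. Then u ≤ v in Ω. -/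
open Filter Set MeasureTheory Bornology

/-- The second derivative is nonpositive at a local maximum. -/
theorem IsLocalMax.deriv_deriv_nonpos {f : ℝ → ℝ} {x : ℝ} (h : IsLocalMax f x)
    (hc : ContinuousAt f x) : deriv (deriv f) x ≤ 0 := by
  by_contra! hpos
  have hmin := isLocalMin_of_deriv_deriv_pos hpos h.deriv_eq_zero hc
  have hconst : f =ᶠ[nhds x] fun _ => f x := by
    filter_upwards [h, hmin] with y h1 h2 using le_antisymm h1 h2
  have := hconst.deriv.deriv_eq
  simp at this
  exact hpos.ne' this

section SecondDerivatives

variable {E : Type*} [NormedAddCommGroup E] [NormedSpace ℝ E] {f g : E → ℝ} {x : E}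

theorem ContDiffAt.eventually_differentiableAt_of_two (hf : ContDiffAt ℝ 2 f x) :
    ∀ᶠ y in nhds x, DifferentiableAt ℝ f y :=
  (hf.eventually (by simp)).mono fun _ hy => hy.differentiableAt (by simp)

theorem ContDiffAt.differentiableAt_fderiv_apply (hf : ContDiffAt ℝ 2 f x) (e : E) :
    DifferentiableAt ℝ (fun y => fderiv ℝ f y e) x :=
  ((hf.fderiv_right (m := 1) (by norm_num)).differentiableAt (by simp)).clm_apply
    (differentiableAt_const e)

theorem IsLocalMax.fderiv_fderiv_apply_nonpos (h : IsLocalMax f x) (hf : ContDiffAt ℝ 2 f x)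
    (e : E) : fderiv ℝ (fun y => fderiv ℝ f y e) x e ≤ 0 := by
  have hline (t : ℝ) : HasDerivAt (fun t : ℝ => x + t • e) e t := by
    simpa using ((hasDerivAt_id t).smul_const e).const_add x
  have htend : Tendsto (fun t : ℝ => x + t • e) (nhds 0) (nhds x) := by
    simpa using (hline 0).continuousAt.tendsto
  have hderiv : deriv (fun t : ℝ => f (x + t • e)) =ᶠ[nhds 0]
      fun t => fderiv ℝ f (x + t • e) e := by
    filter_upwards [htend.eventually hf.eventually_differentiableAt_of_two] with t ht
    exact (ht.hasFDerivAt.comp_hasDerivAt t (hline t)).deriv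
  have hsecond : deriv (deriv fun t : ℝ => f (x + t • e)) 0 =
      fderiv ℝ (fun y => fderiv ℝ f y e) x e := by
    rw [hderiv.deriv_eq]
    have hd : HasFDerivAt (fun y => fderiv ℝ f y e) (fderiv ℝ (fun y => fderiv ℝ f y e) x)
        (x + (0 : ℝ) • e) := by
      simpa using (hf.differentiableAt_fderiv_apply e).hasFDerivAt
    exact (hd.comp_hasDerivAt (0 : ℝ) (hline 0)).deriv
  rw [← hsecond]
  have hmax : IsLocalMax (fun t : ℝ => f (x + t • e)) 0 := by
    filter_upwards [htend.eventually h] with t ht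
    simpa using ht
  refine hmax.deriv_deriv_nonpos ?_
  have hfx : Tendsto f (nhds x) (nhds (f x)) := hf.continuousAt
  simpa [ContinuousAt, Function.comp_def] using hfx.comp htend

theorem fderiv_fderiv_apply_sub_const_mul (hf : ContDiffAt ℝ 2 f x) (hg : ContDiffAt ℝ 2 g x)
    (c : ℝ) (e : E) :
    fderiv ℝ (fun y => fderiv ℝ (fun z => f z - c * g z) y e) x e =
      fderiv ℝ (fun y => fderiv ℝ f y e) x e - c * fderiv ℝ (fun y => fderiv ℝ g y e) x e := by
  have hfirst : (fun y => fderiv ℝ (fun z => f z - c * g z) y e) =ᶠ[nhds x]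
      fun y => fderiv ℝ f y e - c * fderiv ℝ g y e := by
    filter_upwards [hf.eventually_differentiableAt_of_two,
      hg.eventually_differentiableAt_of_two] with y hfy hgy
    rw [fderiv_fun_sub hfy (hgy.const_mul c), fderiv_const_mul hgy]
    simp
  have hge := hg.differentiableAt_fderiv_apply e
  rw [hfirst.fderiv_eq, fderiv_fun_sub (hf.differentiableAt_fderiv_apply e) (hge.const_mul c),
    fderiv_const_mul hge]
  simp

end SecondDerivatives

/-- If `u - c v` has a local maximum at `x`, then `Δu ≤ c Δv` there. -/
theorem laplacianFn_le_of_isLocalMax_sub {N : ℕ} {u v : EuclideanSpace ℝ (Fin N) → ℝ}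
    {x : EuclideanSpace ℝ (Fin N)} {c : ℝ} (hu : ContDiffAt ℝ 2 u x) (hv : ContDiffAt ℝ 2 v x)
    (h : IsLocalMax (fun y => u y - c * v y) x) : laplacianFn u x ≤ c * laplacianFn v x := by
  unfold laplacianFn
  rw [Finset.mul_sum]
  refine Finset.sum_le_sum fun i _ => ?_
  have := h.fderiv_fderiv_apply_nonpos (hu.sub (contDiffAt_const.mul hv))
    (EuclideanSpace.single i 1)
  rw [fderiv_fderiv_apply_sub_const_mul hu hv] at this
  linarith

theorem gradient_eq_smul_of_isLocalMax_sub {E : Type*} [NormedAddCommGroup E]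
    [InnerProductSpace ℝ E] [CompleteSpace E] {u v : E → ℝ} {x : E} {c : ℝ}
    (hu : DifferentiableAt ℝ u x) (hv : DifferentiableAt ℝ v x)
    (h : IsLocalMax (fun y => u y - c * v y) x) : gradient u x = c • gradient v x := by
  have hzero := h.hasFDerivAt_eq_zero (hu.hasFDerivAt.sub (hv.hasFDerivAt.const_mul c))
  simp [gradient, sub_eq_zero.mp hzero]

/-- comparison principle. If `u` solves
`-Δu = p(x)(F(u) + |∇u|^a)` in a bounded domain `Ω` with `u > 0` in `Ω`, `u = 0` on `∂Ω`,
and `v` is a positive supersolution, then `u ≤ v` in `Ω`. -/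
theorem comparison_principle
    {N : ℕ} (Ω : Set (EuclideanSpace ℝ (Fin N)))
    (hΩ_open : IsOpen Ω) (hΩ_bdd : IsBounded Ω) (hΩ_conn : IsConnected Ω)
    (a : ℝ) (ha0 : 0 < a) (ha1 : a < 1)
    (p : EuclideanSpace ℝ (Fin N) → ℝ)
    (hp_cont : ContinuousOn p (closure Ω))
    (hp_pos : ∀ x ∈ closure Ω, 0 < p x)
    (F : ℝ → ℝ)
    (hF_pos : ∀ t > (0:ℝ), 0 < F t)
    (hF_dec : StrictAntiOn (fun t => F t / t) (Ioi 0))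
    (u : EuclideanSpace ℝ (Fin N) → ℝ)
    (hu_cont : ContinuousOn u (closure Ω))
    (hu_smooth : ContDiffOn ℝ 2 u Ω)
    (hu_eq : ∀ x ∈ Ω, -laplacianFn u x = p x * (F (u x) + ‖gradient u x‖ ^ a))
    (hu_pos : ∀ x ∈ Ω, 0 < u x)
    (hu_bdry : ∀ x ∈ frontier Ω, u x = 0)
    (v : EuclideanSpace ℝ (Fin N) → ℝ)
    (hv_cont : ContinuousOn v (closure Ω))
    (hv_smooth : ContDiffOn ℝ 2 v Ω)
    (hv_ineq : ∀ x ∈ Ω, p x * (F (v x) + ‖gradient v x‖ ^ a) ≤ -laplacianFn v x)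
    (hv_pos : ∀ x ∈ closure Ω, 0 < v x) :
    ∀ x ∈ Ω, u x ≤ v x := by
  by_contra! hcon
  obtain ⟨y, hyΩ, hy⟩ := hcon
  have hyv := hv_pos y (subset_closure hyΩ)
  obtain ⟨x, hx, hmax⟩ := hΩ_bdd.isCompact_closure.exists_isMaxOn ⟨y, subset_closure hyΩ⟩
    (hu_cont.div hv_cont fun z hz => (hv_pos z hz).ne')
  set M := u x / v x with hM
  have hvx := hv_pos x hx
  have hM1 : 1 < M := ((one_lt_div hyv).2 hy).trans_le (hmax (subset_closure hyΩ))
  have hux : u x = M * v x := by rw [hM, div_mul_cancel₀ _ hvx.ne']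
  have hxΩ : x ∈ Ω := by
    by_contra hn
    have : u x = 0 := hu_bdry x (by rw [hΩ_open.frontier_eq]; exact ⟨hx, hn⟩)
    rw [hM, this, zero_div] at hM1
    linarith
  have hΩx := hΩ_open.mem_nhds hxΩ
  have hux2 := hu_smooth.contDiffAt hΩx
  have hvx2 := hv_smooth.contDiffAt hΩx
  have hloc : IsLocalMax (fun z => u z - M * v z) x := by
    filter_upwards [hΩx] with z hz
    have : u z / v z ≤ M := hmax (subset_closure hz)
    rw [div_le_iff₀ (hv_pos z (subset_closure hz))] at this
    linarith
  have hlap := laplacianFn_le_of_isLocalMax_sub hux2 hvx2 hloc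
  have hgrad := gradient_eq_smul_of_isLocalMax_sub (hux2.differentiableAt (by simp))
    (hvx2.differentiableAt (by simp)) hloc
  have hM0 : 0 < M := by linarith
  have hFlt : F (u x) < M * F (v x) := by
    have := hF_dec (mem_Ioi.2 hvx) (mem_Ioi.2 (hu_pos x hxΩ)) (by rw [hux]; nlinarith)
    simp only [hux] at this ⊢
    rw [div_lt_div_iff₀ (by positivity) hvx] at this
    nlinarith
  have hpow : ‖gradient u x‖ ^ a ≤ M * ‖gradient v x‖ ^ a := by
    rw [hgrad, norm_smul, Real.norm_of_nonneg hM0.le, Real.mul_rpow hM0.le (norm_nonneg _)]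
    gcongr
    simpa using Real.rpow_le_rpow_of_exponent_le hM1.le ha1.le
  have hrhs : p x * (F (u x) + ‖gradient u x‖ ^ a) <
      M * (p x * (F (v x) + ‖gradient v x‖ ^ a)) := by
    rw [mul_left_comm, mul_add M]
    exact mul_lt_mul_of_pos_left (add_lt_add_of_lt_of_le hFlt hpow) (hp_pos x hx)
  have := mul_le_mul_of_nonneg_left (hv_ineq x hxΩ) hM0.le
  linarith [hu_eq x hxΩ]
end

section
/- Let N ≥ 3, let g ∈ C¹(0,∞) be positive and decreasing with lim_{t→0+} g(t) = +∞, let φ : [0,∞) → (0,∞) be continuous with ∫_1^∞ t φ(t) dt < ∞, let Φ(r) = r^{1−N} ∫_0^r t^{N−1} φ(t) dt, let k > 0, and set ξ(x) = k ∫_{|x|}^∞ Φ(t) dt. The map t ↦ ∫_0^t 1/(g(s)+1) ds is a bijection from [0,∞) onto [0,∞), so one can define w : ℝ^N → (0,∞) implicitly by ∫_0^{w(x)} 1/(g(t)+1) dt = ξ(x) for all x ∈ ℝ^N. Then w ∈ C²(ℝ^N), w(x) → 0 as |x| → ∞, and |∇w(x)| = k Φ(|x|)(g(w(x)) + 1)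 for all x ∈ ℝ^N. -/
open Filter Set MeasureTheory

/-- `Φ(r) = r^{1-N} ∫_0^r t^{N-1} φ(t) dt`. -/
noncomputable def radialPhi (N : ℕ) (φ : ℝ → ℝ) (r : ℝ) : ℝ :=
  (∫ t in (0:ℝ)..r, t ^ (N - 1) * φ t) / r ^ (N - 1)

section Radial

variable {E : Type*} [NormedAddCommGroup E] [InnerProductSpace ℝ E]

theorem hasFDerivAt_norm_of_ne_zero {x : E} (hx : x ≠ 0) :
    HasFDerivAt (fun y : E => ‖y‖) (‖x‖⁻¹ • innerSL ℝ x) x := by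
  have h := (hasStrictFDerivAt_norm_sq x).hasFDerivAt.sqrt (by simpa using hx)
  simp only [Real.sqrt_sq (norm_nonneg _)] at h
  convert h using 1
  ext v
  have : ‖x‖ ≠ 0 := norm_ne_zero_iff.2 hx
  simp
  field_simp

/-- If `H' (r) = r * A r`, then `x ↦ H ‖x‖` has gradient `A ‖x‖ • x`, also at the origin. -/
theorem hasFDerivAt_comp_norm {H A : ℝ → ℝ} (hH : ∀ r, HasDerivAt H (r * A r) r) (x : E) :
    HasFDerivAt (fun y : E => H ‖y‖) (innerSL ℝ (A ‖x‖ • x)) x := by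
  rcases eq_or_ne x 0 with rfl | hx
  · have h := (hH 0).isLittleO
    have ht : Tendsto (fun y : E => ‖y‖) (nhds 0) (nhds 0) := by
      simpa using (continuous_norm (E := E)).tendsto 0
    have h' := h.comp_tendsto ht
    rw [hasFDerivAt_iff_isLittleO]
    refine (h'.norm_right.congr' ?_ ?_).of_norm_right <;>
      simp [Filter.EventuallyEq]
  · have h := (hH ‖x‖).comp_hasFDerivAt x (hasFDerivAt_norm_of_ne_zero hx)
    have : ‖x‖ ≠ 0 := norm_ne_zero_iff.2 hx
    refine h.congr_fderiv ?_
    rw [smul_smul, map_smul]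
    congr 1
    field_simp

/-- A field `A ‖x‖ • x` is `C¹` as soon as `r * A' (r)` extends continuously by `0` at `r = 0`. -/
theorem contDiff_comp_norm_smul {A B : ℝ → ℝ} (hA : Continuous A) (hB : Continuous B)
    (hB0 : B 0 = 0) (hAB : ∀ r, 0 < r → HasDerivAt A (B r / r) r) :
    ContDiff ℝ 1 (fun x : E => A ‖x‖ • x) := by
  rw [contDiff_one_iff_hasFDerivAt]
  refine ⟨fun x => A ‖x‖ • ContinuousLinearMap.id ℝ E +
    ((B ‖x‖ / ‖x‖ ^ 2) • innerSL ℝ x).smulRight x, ?_, fun x => ?_⟩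
  · refine (by fun_prop : Continuous fun x : E => A ‖x‖ • ContinuousLinearMap.id ℝ E).add ?_
    rw [continuous_iff_continuousAt]
    intro x
    rcases eq_or_ne x 0 with rfl | hx
    · have hz : Tendsto (fun y : E => |B ‖y‖|) (nhds 0) (nhds 0) := by
        have : Continuous fun y : E => |B ‖y‖| := by fun_prop
        simpa [hB0] using this.tendsto 0
      rw [ContinuousAt]
      simp only [map_zero, smul_zero, ContinuousLinearMap.smulRight_zero]
      refine squeeze_zero_norm (fun y => ?_) hz
      rcases eq_or_ne y 0 with rfl | hy
      · simp [hB0]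
      have : ‖y‖ ≠ 0 := norm_ne_zero_iff.2 hy
      rw [ContinuousLinearMap.norm_smulRight_apply, norm_smul, innerSL_apply_norm, norm_div,
        Real.norm_eq_abs, norm_pow, norm_norm]
      apply le_of_eq
      field_simp
    · have : ‖x‖ ^ 2 ≠ 0 := pow_ne_zero _ (norm_ne_zero_iff.2 hx)
      have h1 : ContinuousAt (fun y : E => (B ‖y‖ / ‖y‖ ^ 2) • innerSL ℝ y) x :=
        ContinuousAt.smul (f := fun y : E => B ‖y‖ / ‖y‖ ^ 2) (g := fun y : E => innerSL ℝ y)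
          (ContinuousAt.div (f := fun y : E => B ‖y‖) (g := fun y : E => ‖y‖ ^ 2)
            (by fun_prop) (by fun_prop) this) (by fun_prop)
      exact ((ContinuousLinearMap.smulRightL ℝ E E).continuous.continuousAt.comp h1).clm_apply
        continuousAt_id
  · rcases eq_or_ne x 0 with rfl | hx
    · rw [hasFDerivAt_iff_isLittleO]
      have hz : (fun y : E => A ‖y‖ - A 0) =o[nhds 0] (fun _ => (1 : ℝ)) := by
        rw [Asymptotics.isLittleO_one_iff]
        have : Continuous fun y : E => A ‖y‖ - A 0 := by fun_prop
        simpa using this.tendsto 0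
      have := hz.smul_isBigO (Asymptotics.isBigO_refl (fun y : E => y) (nhds 0))
      simpa [sub_smul] using this
    · have hr : 0 < ‖x‖ := norm_pos_iff.2 hx
      have h := ((hAB ‖x‖ hr).comp_hasFDerivAt x (hasFDerivAt_norm_of_ne_zero hx)).fun_smul
        (hasFDerivAt_id x)
      refine h.congr_fderiv ?_
      rw [smul_smul, ← div_eq_mul_inv, div_div, ← sq]
      rfl

end Radial

/-- The weighted mean `∫_0^1 s^n φ(rs) ds`, a continuous extension of
`r^{-n-1} ∫_0^r t^n φ(t) dt` to all `r`. -/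
noncomputable def radialMean (n : ℕ) (φ : ℝ → ℝ) (r : ℝ) : ℝ :=
  ∫ s in (0:ℝ)..1, s ^ n * φ (r * s)

theorem continuous_radialMean {n : ℕ} {φ : ℝ → ℝ} (hφ : Continuous φ) :
    Continuous (radialMean n φ) :=
  intervalIntegral.continuous_parametric_intervalIntegral_of_continuous'
    (f := fun r s => s ^ n * φ (r * s)) (by fun_prop) 0 1

theorem pow_mul_radialMean (n : ℕ) (φ : ℝ → ℝ) (r : ℝ) :
    r ^ (n + 1) * radialMean n φ r = ∫ t in (0:ℝ)..r, t ^ n * φ t := by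
  have h := intervalIntegral.smul_integral_comp_mul_left (a := 0) (b := 1)
    (fun t => t ^ n * φ t) r
  simp only [mul_zero, mul_one, smul_eq_mul, mul_pow, mul_assoc] at h
  rw [intervalIntegral.integral_const_mul] at h
  rw [← h, radialMean]
  ring

theorem radialMean_zero (n : ℕ) (φ : ℝ → ℝ) : radialMean n φ 0 = φ 0 / (n + 1) := by
  simp [radialMean, intervalIntegral.integral_mul_const]
  ring

theorem radialMean_pos {n : ℕ} {φ : ℝ → ℝ} (hφ : Continuous φ) (hpos : ∀ t, 0 < φ t) (r : ℝ) :
    0 < radialMean n φ r := by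
  apply intervalIntegral.intervalIntegral_pos_of_pos_on
  · exact Continuous.intervalIntegrable (by fun_prop) _ _
  · exact fun s hs => mul_pos (pow_pos hs.1 n) (hpos _)
  · exact one_pos

theorem hasDerivAt_radialMean {n : ℕ} {φ : ℝ → ℝ} (hφ : Continuous φ) {r : ℝ} (hr : 0 < r) :
    HasDerivAt (radialMean n φ) ((φ r - (n + 1) * radialMean n φ r) / r) r := by
  have hI : HasDerivAt (fun u => ∫ t in (0:ℝ)..u, t ^ n * φ t) (r ^ n * φ r) r :=
    (Continuous.integral_hasStrictDerivAt (f := fun t => t ^ n * φ t)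
      (by fun_prop) 0 r).hasDerivAt
  have h := hI.fun_div (hasDerivAt_pow (n + 1) r) (pow_ne_zero _ hr.ne')
  have heq : radialMean n φ =ᶠ[nhds r]
      fun u => (∫ t in (0:ℝ)..u, t ^ n * φ t) / u ^ (n + 1) := by
    filter_upwards [lt_mem_nhds hr] with u hu
    have : u ^ (n + 1) ≠ 0 := pow_ne_zero _ hu.ne'
    rw [← pow_mul_radialMean]
    field_simp
  refine (h.congr_of_eventuallyEq heq).congr_deriv ?_
  rw [← pow_mul_radialMean]
  push_cast
  field_simp
  ring

theorem radialPhi_eq {n : ℕ} {φ ψ : ℝ → ℝ} (h : ∀ t, 0 ≤ t → ψ t = φ t) {r : ℝ} (hr : 0 ≤ r) :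
    radialPhi (n + 1) φ r = r * radialMean n ψ r := by
  have : (∫ t in (0:ℝ)..r, t ^ n * φ t) = ∫ t in (0:ℝ)..r, t ^ n * ψ t := by
    refine intervalIntegral.integral_congr fun t ht => ?_
    rw [uIcc_of_le hr] at ht
    simp only [h t ht.1]
  rw [radialPhi, Nat.add_sub_cancel, this, ← pow_mul_radialMean]
  rcases hr.eq_or_lt with rfl | hr
  · simp
  · field_simp
    ring

section Reciprocal

variable {g : ℝ → ℝ}

theorem continuous_indicator_one_div_add_one (hg : ContinuousOn g (Ioi 0))
    (hpos : ∀ t > (0:ℝ), 0 < g t) (hlim : Tendsto g (nhdsWithin 0 (Ioi 0)) atTop) :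
    Continuous ((Ioi (0:ℝ)).indicator fun s => 1 / (g s + 1)) := by
  rw [continuous_iff_continuousAt]
  intro t
  rcases lt_trichotomy t 0 with ht | rfl | ht
  · refine (continuousAt_const (y := (0:ℝ))).congr ?_
    filter_upwards [gt_mem_nhds ht] with s hs
    rw [indicator_of_notMem (by simpa using le_of_lt hs)]
  · rw [continuousAt_iff_continuous_left'_right']
    constructor
    · refine (continuousWithinAt_const (b := (0:ℝ))).congr (fun s hs => ?_) (by simp)
      rw [indicator_of_notMem (by simpa using le_of_lt hs)]
    · rw [ContinuousWithinAt, indicator_of_notMem (by simp)]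
      have h : Tendsto (fun s => 1 / (g s + 1)) (nhdsWithin 0 (Ioi 0)) (nhds 0) := by
        simpa [Pi.inv_def] using (tendsto_atTop_add_const_right _ (1:ℝ) hlim).inv_tendsto_atTop
      refine h.congr' ?_
      filter_upwards [self_mem_nhdsWithin] with s hs
      rw [indicator_of_mem hs]
  · have h : ContinuousAt (fun s => 1 / (g s + 1)) t := by
      have := hpos t ht
      exact continuousAt_const.div ((hg.continuousAt (Ioi_mem_nhds ht)).add continuousAt_const)
        (by positivity)
    refine h.congr ?_
    filter_upwards [lt_mem_nhds ht] with s hs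
    rw [indicator_of_mem (mem_Ioi.2 hs)]

theorem bijOn_primitive_Ici {h : ℝ → ℝ} (hc : Continuous h) (hpos : ∀ t > 0, 0 < h t)
    (hmono : MonotoneOn h (Ioi 0)) :
    StrictMonoOn (fun t => ∫ s in (0:ℝ)..t, h s) (Ici 0) ∧
      BijOn (fun t => ∫ s in (0:ℝ)..t, h s) (Ici 0) (Ici 0) := by
  have hd : ∀ t, HasDerivAt (fun t => ∫ s in (0:ℝ)..t, h s) (h t) t := fun t =>
    (hc.integral_hasStrictDerivAt 0 t).hasDerivAt
  have hcont : Continuous fun t => ∫ s in (0:ℝ)..t, h s :=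
    continuous_iff_continuousAt.2 fun t => (hd t).continuousAt
  have hsm : StrictMonoOn (fun t => ∫ s in (0:ℝ)..t, h s) (Ici 0) := by
    refine strictMonoOn_of_deriv_pos (convex_Ici 0) hcont.continuousOn fun t ht => ?_
    rw [interior_Ici] at ht
    rw [(hd t).deriv]
    exact hpos t ht
  refine ⟨hsm, fun t ht => ?_, hsm.injOn, fun y hy => ?_⟩
  · simpa using hsm.monotoneOn self_mem_Ici ht ht
  · have h1 := hpos 1 one_pos
    have hy' : 0 ≤ y := hy
    have hT : (1:ℝ) ≤ 1 + y / h 1 := le_add_of_nonneg_right (by positivity)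
    have hsplit := intervalIntegral.integral_add_adjacent_intervals
      (hc.intervalIntegrable 0 1) (hc.intervalIntegrable 1 (1 + y / h 1)) (μ := volume)
    have hlow : ∫ _ in (1:ℝ)..(1 + y / h 1), h 1 ≤ ∫ s in (1:ℝ)..(1 + y / h 1), h s := by
      refine intervalIntegral.integral_mono_on hT (by simp) (hc.intervalIntegrable _ _)
        fun s hs => ?_
      exact hmono (by simp) (mem_Ioi.2 (one_pos.trans_le hs.1)) hs.1
    rw [intervalIntegral.integral_const, smul_eq_mul, add_sub_cancel_left,
      div_mul_cancel₀ _ h1.ne'] at hlow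
    have h01 : 0 ≤ ∫ s in (0:ℝ)..1, h s := by
      simpa using hsm.monotoneOn self_mem_Ici (mem_Ici.2 zero_le_one) zero_le_one
    obtain ⟨t, ht, hty⟩ := intermediate_value_Icc (zero_le_one.trans hT) hcont.continuousOn
      (show y ∈ Icc _ _ by
        simp only [intervalIntegral.integral_same]
        exact ⟨hy', by linarith⟩)
    exact ⟨t, ht.1, hty⟩

end Reciprocal

/-- A positive solution `w` of `F (w x) = ξ x` inherits the regularity of `F` and `ξ`, provided
`F` is injective on `(0, ∞)` with nonvanishing derivative there. -/
theorem contDiff_of_comp_eq {E : Type*} [NormedAddCommGroup E] [NormedSpace ℝ E]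
    {n : WithTop ℕ∞} (hn : n ≠ 0) {F f : ℝ → ℝ} {w ξ : E → ℝ}
    (hF : ContDiffOn ℝ n F (Ioi 0)) (hFd : ∀ t > 0, HasDerivAt F (f t) t)
    (hf : ∀ t > 0, f t ≠ 0) (hinj : InjOn F (Ioi 0)) (hξ : ContDiff ℝ n ξ)
    (hw : ∀ x, 0 < w x) (hFw : ∀ x, F (w x) = ξ x) : ContDiff ℝ n w := by
  rw [contDiff_iff_contDiffAt]
  intro x
  have hFx : ContDiffAt ℝ n F (w x) := hF.contDiffAt (Ioi_mem_nhds (hw x))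
  have hdx := (hFd _ (hw x)).hasFDerivAt_equiv (hf _ (hw x))
  have hinv := hFx.to_localInverse hdx hn
  have happ := hFx.localInverse_apply_image hdx hn
  have hright := (hFx.hasStrictFDerivAt' hdx hn).eventually_right_inverse
  rw [hFw] at hinv happ hright
  refine (hinv.comp x hξ.contDiffAt).congr_of_eventuallyEq ?_
  have hξt : Tendsto ξ (nhds x) (nhds (ξ x)) := hξ.continuous.tendsto x
  have hpos := (hinv.continuousAt.eventually (lt_mem_nhds (happ ▸ hw x)))
  filter_upwards [hξt.eventually hright, hξt.eventually hpos] with y hy hy'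
  exact hinj (hw y) hy' ((hFw y).trans hy.symm)

/-- the map `t ↦ ∫_0^t 1/(g(s)+1) ds` is a bijection from `[0,∞)`
onto `[0,∞)`, and the function `w` implicitly defined by
`∫_0^{w(x)} 1/(g(t)+1) dt = ξ(x)`, where `ξ(x) = k ∫_{|x|}^∞ Φ(t) dt`, is `C²`,
tends to `0` at infinity, and satisfies `|∇w(x)| = k Φ(|x|)(g(w(x)) + 1)`. -/
theorem implicit_w_properties
    {N : ℕ} (hN : 3 ≤ N)
    (g : ℝ → ℝ)
    (hg_smooth : ContDiffOn ℝ 1 g (Ioi 0))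
    (hg_pos : ∀ t > (0:ℝ), 0 < g t)
    (hg_dec : StrictAntiOn g (Ioi 0))
    (hg1 : Tendsto g (nhdsWithin 0 (Ioi 0)) atTop)
    (hg_nonneg : ∀ t ≥ (0:ℝ), 0 ≤ g t)
    (φ : ℝ → ℝ)
    (hφ_cont : ContinuousOn φ (Ici 0))
    (hφ_pos : ∀ r ≥ (0:ℝ), 0 < φ r)
    (hφ_int : IntegrableOn (fun t => t * φ t) (Ioi 1))
    (k : ℝ) (hk : 0 < k)
    (ξ : EuclideanSpace ℝ (Fin N) → ℝ)
    (hξ_def : ∀ x, ξ x = k * ∫ t in Ioi ‖x‖, radialPhi N φ t) :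
    Set.BijOn (fun t => ∫ s in (0:ℝ)..t, 1 / (g s + 1)) (Ici 0) (Ici 0) ∧
    ∀ w : EuclideanSpace ℝ (Fin N) → ℝ,
      (∀ x, 0 < w x) →
      (∀ x, (∫ s in (0:ℝ)..(w x), 1 / (g s + 1)) = ξ x) →
      ContDiff ℝ 2 w ∧
      Tendsto w (cocompact _) (nhds 0) ∧
      (∀ x, ‖gradient w x‖ = k * radialPhi N φ ‖x‖ * (g (w x) + 1)) := by
  obtain ⟨n, rfl⟩ : ∃ n, N = n + 1 := ⟨N - 1, by omega⟩
  have hgc : ContinuousOn g (Ioi 0) := hg_smooth.continuousOn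
  set h : ℝ → ℝ := (Ioi (0:ℝ)).indicator fun s => 1 / (g s + 1)
  have hval : ∀ t > 0, h t = 1 / (g t + 1) := fun t ht => indicator_of_mem (mem_Ioi.2 ht) _
  have hhc : Continuous h := continuous_indicator_one_div_add_one hgc hg_pos hg1
  have hhpos : ∀ t > 0, 0 < h t := fun t ht => by
    have := hg_pos t ht
    rw [hval t ht]
    positivity
  have hhmono : MonotoneOn h (Ioi 0) := fun s hs t ht hst => by
    rw [hval s hs, hval t ht]
    have := hg_pos t ht
    have := hg_dec.antitoneOn hs ht hst
    gcongr
  obtain ⟨hsm, hbij⟩ := bijOn_primitive_Ici hhc hhpos hhmono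
  have hFeq : ∀ t ≥ 0, ∫ s in (0:ℝ)..t, 1 / (g s + 1) = ∫ s in (0:ℝ)..t, h s := fun t ht => by
    refine intervalIntegral.integral_congr_ae (ae_of_all _ fun s hs => ?_)
    rw [uIoc_of_le ht] at hs
    exact (hval s hs.1).symm
  refine ⟨hbij.congr fun t ht => (hFeq t ht).symm, fun w hw hweq => ?_⟩
  set F : ℝ → ℝ := fun t => ∫ s in (0:ℝ)..t, h s with hF
  have hFd : ∀ t, HasDerivAt F (h t) t := fun t => (hhc.integral_hasStrictDerivAt 0 t).hasDerivAt
  have hFw : ∀ x, F (w x) = ξ x := fun x => by rw [← hweq x, hFeq _ (hw x).le]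
  have hF2 : ContDiffOn ℝ 2 F (Ioi 0) := by
    rw [show (2 : WithTop ℕ∞) = 1 + 1 from rfl, contDiffOn_succ_iff_deriv_of_isOpen isOpen_Ioi]
    refine ⟨fun t _ => (hFd t).differentiableAt.differentiableWithinAt, by simp, ?_⟩
    refine ContDiffOn.congr (f := fun s => 1 / (g s + 1)) ?_ fun t ht => ?_
    · exact contDiffOn_const.div (hg_smooth.add contDiffOn_const) fun t ht => by
        have := hg_pos t ht
        positivity
    · rw [(hFd t).deriv, hval t ht]
  have hFpos : ∀ t > 0, 0 < F t := fun t ht => by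
    simpa [hF] using hsm self_mem_Ici (mem_Ici.2 (le_of_lt ht)) ht
  -- the positivity of `ξ` forces its defining integral to converge
  have hΦ_int : IntegrableOn (radialPhi (n + 1) φ) (Ioi 0) := by
    by_contra hni
    have h0 := hFpos _ (hw 0)
    rw [hFw, hξ_def, norm_zero, integral_undef hni, mul_zero] at h0
    exact h0.false
  set ψ : ℝ → ℝ := fun t => φ (max t 0)
  have hψ : Continuous ψ := hφ_cont.comp_continuous (by fun_prop) fun t => le_max_right t 0
  have hψφ : ∀ t, 0 ≤ t → ψ t = φ t := fun t ht => by simp [ψ, ht]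
  set A : ℝ → ℝ := radialMean n ψ
  have hA : Continuous A := continuous_radialMean hψ
  have hApos : ∀ r, 0 < A r := radialMean_pos hψ fun t => hφ_pos _ (le_max_right t 0)
  have hΦ : ∀ r ≥ 0, radialPhi (n + 1) φ r = r * A r := fun r hr => radialPhi_eq hψφ hr
  set H : ℝ → ℝ := fun r => ∫ t in (0:ℝ)..r, t * A t
  have hH : ∀ r, HasDerivAt H (r * A r) r := fun r =>
    (Continuous.integral_hasStrictDerivAt (f := fun t => t * A t)
      (by fun_prop) 0 r).hasDerivAt
  have hHΦ : ∀ r ≥ 0, ∫ t in (0:ℝ)..r, radialPhi (n + 1) φ t = H r := fun r hr => by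
    refine intervalIntegral.integral_congr fun t ht => ?_
    rw [uIcc_of_le hr] at ht
    exact hΦ t ht.1
  set C : ℝ := ∫ t in Ioi (0:ℝ), radialPhi (n + 1) φ t
  have hξH : ξ = fun x => k * (C - H ‖x‖) := funext fun x => by
    have hsplit : _ = C := intervalIntegral.integral_interval_add_Ioi hΦ_int
      (hΦ_int.mono_set (Ioi_subset_Ioi (norm_nonneg x)))
    rw [hξ_def, ← hHΦ _ (norm_nonneg x), ← hsplit, add_sub_cancel_left]
  have hξd : ∀ x, HasFDerivAt ξ (k • -innerSL ℝ (A ‖x‖ • x)) x := fun x => by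
    rw [hξH]
    exact ((hasFDerivAt_comp_norm hH x).const_sub C).const_mul k
  have hV : ContDiff ℝ 1 fun x : EuclideanSpace ℝ (Fin (n + 1)) => A ‖x‖ • x := by
    refine contDiff_comp_norm_smul (B := fun r => ψ r - (n + 1) * A r) hA (by fun_prop) ?_
      fun r hr => hasDerivAt_radialMean hψ hr
    have : (n + 1 : ℝ) ≠ 0 := by positivity
    simp only [A, radialMean_zero]
    field_simp
    ring
  have hξ2 : ContDiff ℝ 2 ξ := by
    rw [show (2 : WithTop ℕ∞) = 1 + 1 from rfl, contDiff_succ_iff_fderiv]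
    refine ⟨fun x => (hξd x).differentiableAt, by simp, ?_⟩
    rw [funext fun x => (hξd x).fderiv]
    exact (((innerSL ℝ).contDiff.comp hV).neg).const_smul k
  have hw2 : ContDiff ℝ 2 w := contDiff_of_comp_eq two_ne_zero hF2 (fun t _ => hFd t)
    (fun t ht => (hhpos t ht).ne') (hsm.injOn.mono Ioi_subset_Ici_self) hξ2 hw hFw
  refine ⟨hw2, ?_, fun x => ?_⟩
  · have hξ0 : Tendsto ξ (cocompact _) (nhds 0) := by
      have h1 := intervalIntegral_tendsto_integral_Ioi 0 hΦ_int tendsto_id |>.comp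
        (tendsto_norm_cocompact_atTop (E := EuclideanSpace ℝ (Fin (n + 1))))
      simp only [Function.comp_def, id,
        fun x : EuclideanSpace ℝ (Fin (n + 1)) => hHΦ _ (norm_nonneg x)] at h1
      rw [hξH]
      simpa [C] using (h1.const_sub C).const_mul k
    refine tendsto_order.2 ⟨fun a ha => Eventually.of_forall fun x => ha.trans (hw x),
      fun ε hε => ?_⟩
    filter_upwards [hξ0.eventually (gt_mem_nhds (hFpos ε hε))] with x hx
    rw [← hFw] at hx
    exact (hsm.lt_iff_lt (hw x).le (le_of_lt hε)).1 hx
  · have hwd : HasFDerivAt w (fderiv ℝ w x) x := (hw2.differentiable two_ne_zero x).hasFDerivAt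
    have hcomp := (hFd (w x)).comp_hasFDerivAt x hwd
    rw [show F ∘ w = ξ from funext hFw] at hcomp
    have hnorm := congrArg norm (hcomp.unique (hξd x))
    rw [norm_smul, norm_smul, norm_neg, innerSL_apply_norm, norm_smul,
      Real.norm_of_nonneg (hhpos _ (hw x)).le, Real.norm_of_nonneg hk.le,
      Real.norm_of_nonneg (hApos _).le, hval _ (hw x)] at hnorm
    have := hg_pos _ (hw x)
    rw [gradient, LinearIsometryEquiv.norm_map, hΦ _ (norm_nonneg x)]
    field_simp at hnorm
    linarith
end

section
/- Let N ≥ 3, 0 < a < 1, let g ∈ C¹(0,∞) be positive and decreasing with lim_{t→0+} g(t) = +∞, let p : ℝ^N → (0,∞) be continuous, let φ : [0,∞) → (0,∞) be continuous with p(x) ≤ φ(|x|) for all x and ∫_1^∞ t φ(t) dt < ∞, and let Φ(r) = r^{1−N} ∫_0^r t^{N−1} φ(t) dt. Choose k > 2 with k^{1−a} ≥ 2 max_{r≥0} Φ(r)^a, set ξ(x) = k ∫_{|x|}^∞ Φ(t) dt, and define w : ℝ^N → (0,∞) by ∫_0^{w(x)} 1/(g(t)+1) dt = ξ(x). Then w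 satisfies −Δw ≥ p(x)(g(w) + 1 + |∇w|^a) in ℝ^N, w > 0 in ℝ^N, and w(x) → 0 as |x| → ∞. -/
open Filter Set MeasureTheory

lemma hasDerivAt_integral_of_continuous {f : ℝ → ℝ} (hf : Continuous f) (a r : ℝ) :
    HasDerivAt (fun r => ∫ t in a..r, f t) (f r) r :=
  intervalIntegral.integral_hasDerivAt_right (hf.intervalIntegrable _ _)
    hf.aestronglyMeasurable.stronglyMeasurableAtFilter hf.continuousAt

/-- The mean `∫_0^1 u^n f(r u) du`, which for `r > 0` equals `r^{-(n+1)} ∫_0^r t^n f(t) dt`. -/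
noncomputable def powerMean (n : ℕ) (f : ℝ → ℝ) (r : ℝ) : ℝ :=
  ∫ u in (0:ℝ)..1, u ^ n * f (r * u)

lemma continuous_powerMean (n : ℕ) {f : ℝ → ℝ} (hf : Continuous f) :
    Continuous (powerMean n f) := by
  unfold powerMean
  apply intervalIntegral.continuous_parametric_intervalIntegral_of_continuous'
  simp only [Function.uncurry_def]
  fun_prop

lemma powerMean_pos (n : ℕ) {f : ℝ → ℝ} (hf : Continuous f) (hpos : ∀ t, 0 < f t) (r : ℝ) :
    0 < powerMean n f r := by
  apply intervalIntegral.intervalIntegral_pos_of_pos_on _ _ one_pos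
  · exact Continuous.intervalIntegrable (by fun_prop) _ _
  · intro u hu
    have := hpos (r * u)
    have := hu.1
    positivity

lemma powerMean_zero (n : ℕ) (f : ℝ → ℝ) : powerMean n f 0 = f 0 / (n + 1) := by
  simp [powerMean, intervalIntegral.integral_mul_const, integral_pow]
  ring

lemma integral_pow_mul_eq_powerMean (n : ℕ) (f : ℝ → ℝ) (r : ℝ) :
    ∫ t in (0:ℝ)..r, t ^ n * f t = r ^ (n + 1) * powerMean n f r := by
  have h := intervalIntegral.smul_integral_comp_mul_left (a := 0) (b := 1)
    (fun t => t ^ n * f t) r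
  simp only [mul_zero, mul_one, smul_eq_mul] at h
  rw [← h, powerMean, pow_succ', mul_assoc, ← intervalIntegral.integral_const_mul (r ^ n)]
  congr 2
  ext u
  ring

lemma hasDerivAt_powerMean (n : ℕ) {f : ℝ → ℝ} (hf : Continuous f) {r : ℝ} (hr : r ≠ 0) :
    HasDerivAt (powerMean n f) ((f r - (n + 1) * powerMean n f r) / r) r := by
  have h1 : HasDerivAt (fun r => ∫ t in (0:ℝ)..r, t ^ n * f t) (r ^ n * f r) r :=
    hasDerivAt_integral_of_continuous (by fun_prop) 0 r
  have h2 := h1.div (hasDerivAt_pow (n + 1) r) (pow_ne_zero _ hr)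
  have heq : powerMean n f =ᶠ[nhds r]
      (fun r => ∫ t in (0:ℝ)..r, t ^ n * f t) / (fun r => r ^ (n + 1)) := by
    filter_upwards [isOpen_ne.mem_nhds hr] with s hs
    have : s ^ (n + 1) ≠ 0 := pow_ne_zero _ hs
    simp only [Pi.div_apply]
    rw [integral_pow_mul_eq_powerMean]
    field_simp
  refine (h2.congr_of_eventuallyEq heq).congr_deriv ?_
  rw [integral_pow_mul_eq_powerMean]
  push_cast
  field_simp
  ring

lemma radialPhi_eq_mul_powerMean (n : ℕ) (φ : ℝ → ℝ) {r : ℝ} (hr : 0 ≤ r) :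
    radialPhi (n + 1) φ r = r * powerMean n (fun t => φ |t|) r := by
  rcases hr.eq_or_lt with rfl | hr
  · simp [radialPhi]
  have h : ∫ t in (0:ℝ)..r, t ^ n * φ t = ∫ t in (0:ℝ)..r, t ^ n * φ |t| := by
    apply intervalIntegral.integral_congr
    intro t ht
    rw [uIcc_of_le hr.le] at ht
    simp only [abs_of_nonneg ht.1]
  have h' := integral_pow_mul_eq_powerMean n (fun t => φ |t|) r
  rw [radialPhi, add_tsub_cancel_right, h, h']
  have : r ^ n ≠ 0 := by positivity
  rw [pow_succ]
  field_simp

lemma integral_mul_powerMean (n : ℕ) {f : ℝ → ℝ} (hf : Continuous f) {R : ℝ} (hR : 0 ≤ R) :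
    (n - 1) * ∫ t in (0:ℝ)..R, t * powerMean n f t =
      (∫ t in (0:ℝ)..R, t * f t) - R ^ 2 * powerMean n f R := by
  have hc := continuous_powerMean n hf
  have key := intervalIntegral.integral_eq_sub_of_hasDerivAt_of_le
    (f := fun r => (∫ t in (0:ℝ)..r, t * f t) - r ^ 2 * powerMean n f r)
    (f' := fun r => (n - 1) * (r * powerMean n f r)) hR ?_ ?_
    (Continuous.intervalIntegrable (by fun_prop) _ _)
  · simpa using key
  · have : Continuous fun r => ∫ t in (0:ℝ)..r, t * f t :=
      (intervalIntegral.differentiable_integral_of_continuous (by fun_prop)).continuous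
    fun_prop
  · intro r hr
    have h1 : HasDerivAt (fun r => ∫ t in (0:ℝ)..r, t * f t) (r * f r) r :=
      hasDerivAt_integral_of_continuous (by fun_prop) 0 r
    have h2 := h1.sub ((hasDerivAt_pow 2 r).mul (hasDerivAt_powerMean n hf hr.1.ne'))
    refine h2.congr_deriv ?_
    have := hr.1.ne'
    field_simp
    push_cast
    ring

lemma integrableOn_mul_powerMean {n : ℕ} (hn : 2 ≤ n) {f : ℝ → ℝ} (hf : Continuous f)
    (hpos : ∀ t, 0 < f t) (hint : IntegrableOn (fun t => t * f t) (Ioi 1)) :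
    IntegrableOn (fun t => t * powerMean n f t) (Ioi 0) := by
  have hc := continuous_powerMean n hf
  have hn' : (1:ℝ) ≤ n - 1 := by
    have : (2:ℝ) ≤ n := by exact_mod_cast hn
    linarith
  have hint0 : IntegrableOn (fun t => t * f t) (Ioi 0) := by
    rw [← Ioc_union_Ioi_eq_Ioi (zero_le_one (α := ℝ))]
    exact (Continuous.integrableOn_Ioc (by fun_prop)).union hint
  refine integrableOn_Ioi_of_intervalIntegral_norm_bounded (l := atTop) (b := id)
    (∫ t in Ioi 0, t * f t) 0 (fun i => Continuous.integrableOn_Ioc (by fun_prop)) tendsto_id ?_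
  filter_upwards [eventually_ge_atTop 0] with R hR
  simp only [id]
  have e1 : ∫ t in (0:ℝ)..R, ‖t * powerMean n f t‖ = ∫ t in (0:ℝ)..R, t * powerMean n f t := by
    apply intervalIntegral.integral_congr
    intro t ht
    rw [uIcc_of_le hR] at ht
    exact Real.norm_of_nonneg (mul_nonneg ht.1 (powerMean_pos n hf hpos t).le)
  have h0 : 0 ≤ ∫ t in (0:ℝ)..R, t * powerMean n f t :=
    intervalIntegral.integral_nonneg hR
      fun t ht => mul_nonneg ht.1 (powerMean_pos n hf hpos t).le
  have e2 : ∫ t in (0:ℝ)..R, t * f t ≤ ∫ t in Ioi 0, t * f t := by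
    rw [intervalIntegral.integral_of_le hR]
    refine setIntegral_mono_set hint0 ?_ Ioc_subset_Ioi_self.eventuallyLE
    filter_upwards [ae_restrict_mem measurableSet_Ioi] with t ht
    exact mul_nonneg (le_of_lt ht) (hpos t).le
  have e3 := integral_mul_powerMean n hf hR
  have e4 := mul_nonneg (sq_nonneg R) (powerMean_pos n hf hpos R).le
  rw [e1]
  nlinarith

section Radial

variable {E : Type*} [NormedAddCommGroup E] [InnerProductSpace ℝ E]

lemma hasFDerivAt_integral_norm {q : ℝ → ℝ} (hq : Continuous q) (x : E) :
    HasFDerivAt (fun y : E => ∫ t in (0:ℝ)..‖y‖, t * q t) (q ‖x‖ • innerSL ℝ x) x := by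
  have hs : Continuous fun s => q (Real.sqrt s) / 2 := by fun_prop
  have heq : (fun y : E => ∫ t in (0:ℝ)..‖y‖, t * q t) =
      (fun r => ∫ s in (0:ℝ)..r, q (Real.sqrt s) / 2) ∘ fun y => ‖y‖ ^ 2 := by
    ext y
    have h := intervalIntegral.integral_comp_mul_deriv (a := 0) (b := ‖y‖) (f := fun t => t ^ 2)
      (f' := fun t => 2 * t) (fun t _ => by simpa using hasDerivAt_pow 2 t)
      (Continuous.continuousOn (by fun_prop)) hs
    simp only [ne_eq, OfNat.ofNat_ne_zero, not_false_eq_true, zero_pow] at h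
    simp only [Function.comp_apply]
    rw [← h]
    apply intervalIntegral.integral_congr
    intro t ht
    rw [uIcc_of_le (norm_nonneg y)] at ht
    simp only [Function.comp_apply]
    rw [Real.sqrt_sq ht.1]
    ring
  have h1 : HasDerivAt (fun r => ∫ s in (0:ℝ)..r, q (Real.sqrt s) / 2)
      (q (Real.sqrt (‖x‖ ^ 2)) / 2) (‖x‖ ^ 2) :=
    hasDerivAt_integral_of_continuous hs 0 _
  rw [heq]
  refine (h1.comp_hasFDerivAt x (hasStrictFDerivAt_norm_sq x).hasFDerivAt).congr_fderiv ?_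
  ext v
  simp [Real.sqrt_sq (norm_nonneg x)]
  ring

lemma hasFDerivAt_powerMean_norm_mul (n : ℕ) {f : ℝ → ℝ} (hf : Continuous f) (L : E →L[ℝ] ℝ)
    (x : E) :
    HasFDerivAt (fun y : E => powerMean n f ‖y‖ * L y)
      (powerMean n f ‖x‖ • L +
        (L x * (f ‖x‖ - (n + 1) * powerMean n f ‖x‖) / ‖x‖ ^ 2) • innerSL ℝ x) x := by
  rcases eq_or_ne x 0 with rfl | hx
  · have hc : Continuous fun y : E => powerMean n f ‖y‖ :=
      (continuous_powerMean n hf).comp continuous_norm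
    rw [hasFDerivAt_iff_isLittleO_nhds_zero]
    have h1 : (fun y : E => powerMean n f ‖y‖ - powerMean n f ‖(0:E)‖) =o[nhds 0]
        fun _ => (1:ℝ) := by
      rw [Asymptotics.isLittleO_one_iff]
      have := (hc.tendsto 0).sub_const (powerMean n f ‖(0:E)‖)
      simpa using this
    have h2 := h1.mul_isBigO (L.isBigO_id (nhds 0)).norm_right
    simp only [one_mul] at h2
    refine (h2.congr_left ?_).of_norm_right
    intro y
    simp
    ring
  · have hx' : ‖x‖ ≠ 0 := norm_ne_zero_iff.mpr hx
    have hnorm : HasFDerivAt (fun y : E => ‖y‖) (‖x‖⁻¹ • innerSL ℝ x) x := by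
      have h := (hasStrictFDerivAt_norm_sq x).hasFDerivAt.sqrt (by positivity)
      simp only [Real.sqrt_sq (norm_nonneg _)] at h
      refine h.congr_fderiv ?_
      ext v
      simp
      field_simp
    have h := ((hasDerivAt_powerMean n hf hx').comp_hasFDerivAt x hnorm).mul L.hasFDerivAt
    refine h.congr_fderiv ?_
    ext v
    simp
    field_simp

end Radial

section Primitive

variable {g : ℝ → ℝ}

lemma intervalIntegrable_one_div_add_one (hg : ContinuousOn g (Ioi 0))
    (hpos : ∀ t > (0:ℝ), 0 < g t) {a b : ℝ} (ha : 0 ≤ a) (hb : 0 ≤ b) :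
    IntervalIntegrable (fun s => 1 / (g s + 1)) volume a b := by
  have hsub : uIoc a b ⊆ Ioi 0 := fun s hs => (le_min ha hb).trans_lt hs.1
  have hc : ContinuousOn (fun s => 1 / (g s + 1)) (uIoc a b) := by
    refine continuousOn_const.div ((hg.mono hsub).add continuousOn_const) fun s hs => ?_
    have := hpos s (hsub hs)
    positivity
  rw [intervalIntegrable_iff]
  refine IntegrableOn.of_bound (by simp [uIoc]) (hc.aestronglyMeasurable measurableSet_uIoc) 1 ?_
  filter_upwards [ae_restrict_mem measurableSet_uIoc] with s hs
  have := hpos s (hsub hs)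
  rw [Real.norm_of_nonneg (by positivity), div_le_one (by positivity)]
  linarith

lemma strictMonoOn_integral_one_div_add_one (hg : ContinuousOn g (Ioi 0))
    (hpos : ∀ t > (0:ℝ), 0 < g t) :
    StrictMonoOn (fun y => ∫ s in (0:ℝ)..y, 1 / (g s + 1)) (Ici 0) := by
  intro y hy z hz hyz
  have hadd := intervalIntegral.integral_add_adjacent_intervals
    (intervalIntegrable_one_div_add_one hg hpos le_rfl hy)
    (intervalIntegrable_one_div_add_one hg hpos hy hz)
  have hlt : 0 < ∫ s in y..z, 1 / (g s + 1) := by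
    refine intervalIntegral.intervalIntegral_pos_of_pos_on
      (intervalIntegrable_one_div_add_one hg hpos hy hz) (fun s hs => ?_) hyz
    have := hpos s (lt_of_le_of_lt hy hs.1)
    positivity
  simp only
  linarith

lemma hasStrictDerivAt_integral_one_div_add_one (hg : ContinuousOn g (Ioi 0))
    (hpos : ∀ t > (0:ℝ), 0 < g t) {y : ℝ} (hy : 0 < y) :
    HasStrictDerivAt (fun y => ∫ s in (0:ℝ)..y, 1 / (g s + 1)) (1 / (g y + 1)) y := by
  have hc : ContinuousOn (fun s => 1 / (g s + 1)) (Ioi 0) := by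
    refine continuousOn_const.div (hg.add continuousOn_const) fun s hs => ?_
    have := hpos s hs
    positivity
  exact intervalIntegral.integral_hasStrictDerivAt_right
    (intervalIntegrable_one_div_add_one hg hpos le_rfl hy.le)
    (hc.stronglyMeasurableAtFilter isOpen_Ioi y hy) (hc.continuousAt (Ioi_mem_nhds hy))

end Primitive

lemma continuousAt_of_strictMonoOn_comp {X : Type*} [TopologicalSpace X] {G : ℝ → ℝ}
    (hG : StrictMonoOn G (Ici 0)) {w : X → ℝ} (hw : ∀ x, 0 ≤ w x) {x : X} (hx : 0 < w x)
    (hcont : ContinuousAt (fun y => G (w y)) x) : ContinuousAt w x := by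
  rw [ContinuousAt, tendsto_order] at *
  constructor
  · intro b hb
    have hb' : G (max b 0) < G (w x) := hG (mem_Ici.2 (le_max_right _ _)) (hw x) (max_lt hb hx)
    filter_upwards [hcont.1 _ hb'] with y hy
    exact (le_max_left _ _).trans_lt ((hG.lt_iff_lt (mem_Ici.2 (le_max_right _ _)) (hw y)).1 hy)
  · intro b hb
    have hb0 : (0:ℝ) ≤ b := (hx.trans hb).le
    filter_upwards [hcont.2 _ (hG (hw x) hb0 hb)] with y hy
    exact (hG.lt_iff_lt (hw y) hb0).1 hy

lemma hasFDerivAt_of_comp {E : Type*} [NormedAddCommGroup E] [NormedSpace ℝ E] {G : ℝ → ℝ}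
    {w : E → ℝ} {x : E} {G' : ℝ} {L : E →L[ℝ] ℝ} (hG : HasStrictDerivAt G G' (w x))
    (hG' : G' ≠ 0) (hw : ContinuousAt w x) (hcomp : HasFDerivAt (fun y => G (w y)) L x) :
    HasFDerivAt w (G'⁻¹ • L) x := by
  have hinv : ∀ᶠ y in nhds (w x), hG.localInverse G G' (w x) hG' (G y) = y :=
    (hG.hasStrictFDerivAt_equiv hG').eventually_left_inverse
  have h := (hG.to_localInverse hG').hasDerivAt.comp_hasFDerivAt x hcomp
  refine h.congr_of_eventuallyEq ?_
  filter_upwards [hw.eventually hinv] with y hy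
  exact hy.symm

lemma supersolution_rpow_bound {a k b c : ℝ} (ha0 : 0 < a) (ha1 : a < 1) (hk : 2 < k)
    (hb : 0 ≤ b) (hkb : 2 * b ^ a ≤ k ^ (1 - a)) (hc : 1 ≤ c) :
    c + (c * (k * b)) ^ a ≤ k * c := by
  have hc0 : 0 ≤ c := by linarith
  have hk0 : 0 < k := by linarith
  have h1 : c ^ a ≤ c := by
    simpa using Real.rpow_le_rpow_of_exponent_le hc ha1.le
  have h2 : k ^ a * k ^ (1 - a) = k := by
    rw [← Real.rpow_add hk0]
    simp
  have h3 : 2 * (k ^ a * b ^ a) ≤ k := by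
    have := mul_le_mul_of_nonneg_left hkb (Real.rpow_nonneg hk0.le a)
    nlinarith
  rw [Real.mul_rpow hc0 (by positivity), Real.mul_rpow hk0.le hb]
  have h4 : c ^ a * (k ^ a * b ^ a) ≤ c * (k / 2) := by
    apply mul_le_mul h1 (by linarith) (by positivity) hc0
  nlinarith

/-- the function `w` implicitly defined by
`∫_0^{w(x)} 1/(g(t)+1) dt = ξ(x) = k ∫_{|x|}^∞ Φ(t) dt`, with `k > 2` satisfying
`k^{1-a} ≥ 2 max_{r ≥ 0} Φ(r)^a`, satisfies `-Δw ≥ p(x)(g(w) + 1 + |∇w|^a)` in `ℝ^N`,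
`w > 0`, and `w(x) → 0` as `|x| → ∞`. -/
theorem w_supersolution
    {N : ℕ} (hN : 3 ≤ N)
    (a : ℝ) (ha0 : 0 < a) (ha1 : a < 1)
    (g : ℝ → ℝ)
    (hg_smooth : ContDiffOn ℝ 1 g (Ioi 0))
    (hg_pos : ∀ t > (0:ℝ), 0 < g t)
    (hg_dec : StrictAntiOn g (Ioi 0))
    (hg1 : Tendsto g (nhdsWithin 0 (Ioi 0)) atTop)
    (p : EuclideanSpace ℝ (Fin N) → ℝ)
    (hp_cont : Continuous p)
    (hp_pos : ∀ x, 0 < p x)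
    (φ : ℝ → ℝ)
    (hφ_cont : ContinuousOn φ (Ici 0))
    (hφ_pos : ∀ r ≥ (0:ℝ), 0 < φ r)
    (hpφ : ∀ x, p x ≤ φ ‖x‖)
    (hφ_int : IntegrableOn (fun t => t * φ t) (Ioi 1))
    (k : ℝ) (hk : 2 < k)
    (hka : ∀ r ≥ (0:ℝ), 2 * radialPhi N φ r ^ a ≤ k ^ (1 - a))
    (ξ : EuclideanSpace ℝ (Fin N) → ℝ)
    (hξ_def : ∀ x, ξ x = k * ∫ t in Ioi ‖x‖, radialPhi N φ t)
    (w : EuclideanSpace ℝ (Fin N) → ℝ)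
    (hw_nonneg : ∀ x, 0 ≤ w x)
    (hw_def : ∀ x, (∫ s in (0:ℝ)..(w x), 1 / (g s + 1)) = ξ x) :
    (∀ x, p x * (g (w x) + 1 + ‖gradient w x‖ ^ a) ≤ -laplacianFn w x) ∧
    (∀ x, 0 < w x) ∧
    Tendsto w (cocompact _) (nhds 0) := by
  obtain ⟨n, rfl⟩ : ∃ n, N = n + 1 := ⟨N - 1, by omega⟩
  have hk0 : 0 < k := by linarith
  have hgc : ContinuousOn g (Ioi 0) := hg_smooth.continuousOn
  set f : ℝ → ℝ := fun t => φ |t| with hf_def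
  have hf : Continuous f :=
    hφ_cont.comp_continuous continuous_abs fun t => abs_nonneg t
  have hfpos : ∀ t, 0 < f t := fun t => hφ_pos _ (abs_nonneg t)
  have hfint : IntegrableOn (fun t => t * f t) (Ioi 1) := by
    refine hφ_int.congr_fun (fun t ht => ?_) measurableSet_Ioi
    simp only [hf_def, abs_of_pos (zero_lt_one.trans (mem_Ioi.1 ht))]
  have hmc := continuous_powerMean n hf
  have hmpos := powerMean_pos n hf hfpos
  have hmint := integrableOn_mul_powerMean (by omega : 2 ≤ n) hf hfpos hfint
  have hξ_tail : ∀ x, ξ x = k * ∫ t in Ioi ‖x‖, t * powerMean n f t := by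
    intro x
    rw [hξ_def]
    congr 1
    refine setIntegral_congr_fun measurableSet_Ioi fun t ht => ?_
    exact radialPhi_eq_mul_powerMean n φ ((norm_nonneg x).trans (le_of_lt ht))
  have hξ_eq : ξ = fun x => k * ((∫ t in Ioi 0, t * powerMean n f t) -
      ∫ t in (0:ℝ)..‖x‖, t * powerMean n f t) := by
    ext x
    rw [hξ_tail, ← intervalIntegral.integral_interval_add_Ioi hmint
      (hmint.mono_set (Ioi_subset_Ioi (norm_nonneg x)))]
    ring
  have hξ_fderiv : ∀ x, HasFDerivAt ξ (-(k * powerMean n f ‖x‖) • innerSL ℝ x) x := by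
    intro x
    rw [hξ_eq]
    refine (((hasFDerivAt_integral_norm hmc x).const_sub _).const_mul k).congr_fderiv ?_
    ext v
    simp
    ring
  have hξ_pos : ∀ x, 0 < ξ x := by
    intro x
    rw [hξ_tail]
    refine mul_pos hk0 ?_
    have hpos : ∀ t ∈ Ioi ‖x‖, 0 < t * powerMean n f t :=
      fun t ht => mul_pos ((norm_nonneg x).trans_lt ht) (hmpos t)
    rw [← intervalIntegral.integral_interval_add_Ioi
      (hmint.mono_set (Ioi_subset_Ioi (norm_nonneg x)))
      (hmint.mono_set (Ioi_subset_Ioi (by positivity : (0:ℝ) ≤ ‖x‖ + 1)))]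
    refine add_pos_of_pos_of_nonneg ?_ (setIntegral_nonneg measurableSet_Ioi fun t ht =>
      (hpos t (mem_Ioi.2 ((lt_add_one _).trans (mem_Ioi.1 ht)))).le)
    exact intervalIntegral.intervalIntegral_pos_of_pos_on
      (Continuous.intervalIntegrable (by fun_prop) _ _) (fun t ht => hpos t ht.1) (lt_add_one _)
  have hw_pos : ∀ x, 0 < w x := by
    intro x
    refine (hw_nonneg x).lt_of_ne fun h => ?_
    have h1 := hw_def x
    rw [← h, intervalIntegral.integral_same] at h1
    exact (hξ_pos x).ne h1
  have hmono := strictMonoOn_integral_one_div_add_one hgc hg_pos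
  have hcomp : (fun y => (fun y => ∫ s in (0:ℝ)..y, 1 / (g s + 1)) (w y)) = ξ := funext hw_def
  have hw_cont : ∀ x, ContinuousAt w x := fun x =>
    continuousAt_of_strictMonoOn_comp hmono hw_nonneg (hw_pos x)
      (by rw [hcomp]; exact (hξ_fderiv x).continuousAt)
  have hw_fderiv : ∀ x, HasFDerivAt w
      ((-k * ((g (w x) + 1) * powerMean n f ‖x‖)) • innerSL ℝ x) x := by
    intro x
    have hgp := hg_pos _ (hw_pos x)
    refine (hasFDerivAt_of_comp
      (hasStrictDerivAt_integral_one_div_add_one hgc hg_pos (hw_pos x)) (by positivity)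
      (hw_cont x) (by rw [hcomp]; exact hξ_fderiv x)).congr_fderiv ?_
    ext v
    simp
    ring
  refine ⟨fun x => ?_, hw_pos, ?_⟩
  · have hgp := hg_pos _ (hw_pos x)
    have hg_deriv : HasDerivAt g (derivWithin g (Ioi 0) (w x)) (w x) :=
      ((hg_smooth.differentiableOn one_ne_zero) _ (hw_pos x)).hasDerivWithinAt.hasDerivAt
        (Ioi_mem_nhds (hw_pos x))
    have hg_nonpos : derivWithin g (Ioi 0) (w x) ≤ 0 := hg_dec.antitoneOn.derivWithin_nonpos
    set d := derivWithin g (Ioi 0) (w x)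
    have hgrad : ‖gradient w x‖ = (g (w x) + 1) * (k * (‖x‖ * powerMean n f ‖x‖)) := by
      rw [gradient, LinearIsometryEquiv.norm_map, (hw_fderiv x).fderiv, norm_smul,
        innerSL_apply_norm, norm_mul, norm_neg, Real.norm_of_nonneg hk0.le,
        Real.norm_of_nonneg (mul_nonneg (by positivity) (hmpos _).le)]
      ring
    have hlap : laplacianFn w x = d * (g (w x) + 1) * (k * powerMean n f ‖x‖) ^ 2 * ‖x‖ ^ 2 -
        k * (g (w x) + 1) * φ ‖x‖ := by
      have hpartial : ∀ i, fderiv ℝ (fun y => fderiv ℝ w y (EuclideanSpace.single i 1)) x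
            (EuclideanSpace.single i 1) =
          d * (g (w x) + 1) * (k * powerMean n f ‖x‖) ^ 2 * x i ^ 2 -
            k * (g (w x) + 1) * (powerMean n f ‖x‖ +
              x i ^ 2 * ((f ‖x‖ - (n + 1) * powerMean n f ‖x‖) / ‖x‖ ^ 2)) := by
        intro i
        have heq : (fun y => fderiv ℝ w y (EuclideanSpace.single i 1)) = fun y =>
            -k * ((g (w y) + 1) * (powerMean n f ‖y‖ *
              (EuclideanSpace.proj i : EuclideanSpace ℝ (Fin (n + 1)) →L[ℝ] ℝ) y)) := by
          ext y
          rw [(hw_fderiv y).fderiv]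
          simp [EuclideanSpace.inner_single_right]
          ring
        have h1 := (hg_deriv.comp_hasFDerivAt x (hw_fderiv x)).add_const 1
        have h2 := (h1.mul (hasFDerivAt_powerMean_norm_mul n hf
          (EuclideanSpace.proj i : EuclideanSpace ℝ (Fin (n + 1)) →L[ℝ] ℝ) x)).const_mul (-k)
        have h3 := h2.fderiv
        simp only [Pi.mul_def, Function.comp_apply] at h3
        rw [heq, h3]
        simp [EuclideanSpace.inner_single_right]
        ring
      have hfφ : f ‖x‖ = φ ‖x‖ := by simp [hf_def]
      rw [laplacianFn, Finset.sum_congr rfl fun i _ => hpartial i, Finset.sum_sub_distrib,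
        ← Finset.mul_sum, ← Finset.mul_sum, Finset.sum_add_distrib, ← Finset.sum_mul,
        ← EuclideanSpace.real_norm_sq_eq, ← hfφ]
      congr 2
      simp only [Finset.sum_const, Finset.card_univ, Fintype.card_fin, nsmul_eq_mul]
      push_cast
      rcases eq_or_ne ‖x‖ 0 with h0 | h0
      · rw [h0, powerMean_zero]
        field_simp
        simp
      · field_simp
        ring
    have hbound := supersolution_rpow_bound ha0 ha1 hk
      (mul_nonneg (norm_nonneg x) (hmpos ‖x‖).le)
      (by
        have := hka _ (norm_nonneg x)
        rwa [radialPhi_eq_mul_powerMean n φ (norm_nonneg x)] at this)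
      (by linarith : 1 ≤ g (w x) + 1)
    rw [hlap, hgrad]
    have hdrop : d * (g (w x) + 1) * (k * powerMean n f ‖x‖) ^ 2 * ‖x‖ ^ 2 ≤ 0 := by
      have : 0 ≤ (g (w x) + 1) * (k * powerMean n f ‖x‖) ^ 2 * ‖x‖ ^ 2 := by positivity
      nlinarith
    have h1 := mul_le_mul (hpφ x) hbound (by
      have := mul_nonneg (norm_nonneg x) (hmpos ‖x‖).le
      positivity) (hφ_pos _ (norm_nonneg x)).le
    nlinarith
  · have hξ_lim : Tendsto ξ (cocompact _) (nhds 0) := by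
      have h1 := (intervalIntegral_tendsto_integral_Ioi 0 hmint tendsto_id).comp
        (tendsto_norm_cocompact_atTop (E := EuclideanSpace ℝ (Fin (n + 1))))
      have h2 := (h1.const_sub (∫ t in Ioi 0, t * powerMean n f t)).const_mul k
      rw [hξ_eq]
      simpa [Function.comp_def] using h2
    rw [tendsto_order]
    refine ⟨fun b hb => Eventually.of_forall fun x => hb.trans_le (hw_nonneg x), fun b hb => ?_⟩
    have hb' := hmono (mem_Ici.2 le_rfl) (mem_Ici.2 hb.le) hb
    simp only [intervalIntegral.integral_same] at hb'
    filter_upwards [hξ_lim.eventually_lt_const hb'] with x hx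
    rw [← hw_def] at hx
    exact (hmono.lt_iff_lt (hw_nonneg x) hb.le).1 hx
end

section
/- Let N ≥ 3, 0 < a < 1, let p : ℝ^N → (0,∞) be continuous, let g : (0,∞) → (0,∞) be decreasing, and let f satisfy (f1)–(f2). Suppose w ∈ C²(ℝ^N) satisfies −Δw ≥ p(x)(g(w) + 1 + |∇w|^a) in ℝ^N, w > 0 in ℝ^N, w bounded, and w(x) → 0 as |x| → ∞. Then there exists M > 1 such that M > f(M w(x)) for all x ∈ ℝ^N, and for any such M the function v := M w satisfies −Δv ≥ p(x)(g(v) + f(v) + |∇v|^a) in ℝ^N, v > 0 in ℝ^N, and v(x) → 0 as |x| → ∞. -/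
open Filter Set MeasureTheory

theorem laplacianFn_const_mul {N : ℕ} {u : EuclideanSpace ℝ (Fin N) → ℝ} (hu : ContDiff ℝ 2 u)
    (c : ℝ) (x : EuclideanSpace ℝ (Fin N)) :
    laplacianFn (fun y => c * u y) x = c * laplacianFn u x := by
  have hu1 : Differentiable ℝ u := hu.differentiable (by norm_num)
  have hu2 : Differentiable ℝ (fderiv ℝ u) :=
    (hu.fderiv_right (m := 1) (by norm_num)).differentiable (by norm_num)
  unfold laplacianFn
  rw [Finset.mul_sum]
  refine Finset.sum_congr rfl fun i _ => ?_
  have h1 : (fun y => fderiv ℝ (fun z => c * u z) y (EuclideanSpace.single i 1)) =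
      fun y => c * fderiv ℝ u y (EuclideanSpace.single i 1) := by
    funext y
    rw [fderiv_const_mul (hu1 y)]
    rfl
  have h2 : DifferentiableAt ℝ (fun y => fderiv ℝ u y (EuclideanSpace.single i 1)) x :=
    (hu2 x).clm_apply (differentiableAt_const _)
  rw [h1, fderiv_const_mul h2]
  rfl

theorem norm_gradient_const_mul {E : Type*} [NormedAddCommGroup E] [InnerProductSpace ℝ E]
    [CompleteSpace E] {u : E → ℝ} {x : E} (hu : DifferentiableAt ℝ u x) (c : ℝ) :
    ‖gradient (fun y => c * u y) x‖ = |c| * ‖gradient u x‖ := by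
  simp only [gradient, LinearIsometryEquiv.norm_map]
  rw [fderiv_const_mul hu, norm_smul, Real.norm_eq_abs]

theorem exists_scale_of_sublinear {X : Type*} {f : ℝ → ℝ} {w : X → ℝ}
    (hf_mono : MonotoneOn f (Ici 0)) (hf : Tendsto (fun t => f t / t) atTop (nhds 0))
    (hw_pos : ∀ x, 0 < w x) (hw_bdd : BddAbove (Set.range w)) :
    ∃ M : ℝ, 1 < M ∧ ∀ x, f (M * w x) < M := by
  obtain ⟨C, hC⟩ := hw_bdd
  set K := max C 1
  have hK : 0 < K := lt_max_of_lt_right one_pos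
  have hlim : Tendsto (fun M : ℝ => M * K) atTop atTop := tendsto_id.atTop_mul_const hK
  obtain ⟨M, hfM, hM⟩ :=
    (((hf.comp hlim).eventually_lt_const (inv_pos.2 hK)).and (eventually_gt_atTop 1)).exists
  have hM0 : 0 < M := one_pos.trans hM
  refine ⟨M, hM, fun x => ?_⟩
  have hwK : w x ≤ K := (hC (mem_range_self x)).trans (le_max_left _ _)
  have hle : f (M * w x) ≤ f (M * K) :=
    hf_mono (mul_pos hM0 (hw_pos x)).le (mul_pos hM0 hK).le
      (mul_le_mul_of_nonneg_left hwK hM0.le)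
  refine hle.trans_lt ?_
  calc f (M * K) < K⁻¹ * (M * K) := (div_lt_iff₀ (mul_pos hM0 hK)).1 hfM
    _ = M := by field_simp

/-- if `w` is a bounded positive supersolution of
`-Δw ≥ p(x)(g(w) + 1 + |∇w|^a)` vanishing at infinity, then there is `M > 1` with
`M > f(M w(x))` for all `x`, and for any such `M` the function `v = M w` satisfies
`-Δv ≥ p(x)(g(v) + f(v) + |∇v|^a)` in `ℝ^N`, `v > 0`, `v(x) → 0` as `|x| → ∞`. -/
theorem scaled_supersolution
    {N : ℕ} (hN : 3 ≤ N)
    (a : ℝ) (ha0 : 0 < a) (ha1 : a < 1)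
    (p : EuclideanSpace ℝ (Fin N) → ℝ)
    (hp_cont : Continuous p)
    (hp_pos : ∀ x, 0 < p x)
    (g : ℝ → ℝ)
    (hg_pos : ∀ t > (0:ℝ), 0 < g t)
    (hg_dec : StrictAntiOn g (Ioi 0))
    (f : ℝ → ℝ)
    (hf_cont : ContinuousOn f (Ici 0))
    (hf_nonneg : ∀ t ≥ (0:ℝ), 0 ≤ f t)
    (hf_mono : MonotoneOn f (Ici 0))
    (hf_pos : ∀ t > (0:ℝ), 0 < f t)
    (hf1 : AntitoneOn (fun t => f t / t) (Ioi 0))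
    (hf2 : Tendsto (fun t => f t / t) (nhdsWithin 0 (Ioi 0)) atTop)
    (hf2' : Tendsto (fun t => f t / t) atTop (nhds 0))
    (w : EuclideanSpace ℝ (Fin N) → ℝ)
    (hw_smooth : ContDiff ℝ 2 w)
    (hw_super : ∀ x, p x * (g (w x) + 1 + ‖gradient w x‖ ^ a) ≤ -laplacianFn w x)
    (hw_pos : ∀ x, 0 < w x)
    (hw_bdd : BddAbove (Set.range w))
    (hw_lim : Tendsto w (cocompact _) (nhds 0)) :
    (∃ M : ℝ, 1 < M ∧ ∀ x, f (M * w x) < M) ∧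
    ∀ M : ℝ, 1 < M → (∀ x, f (M * w x) < M) →
      (∀ x, p x * (g (M * w x) + f (M * w x) + ‖gradient (fun y => M * w y) x‖ ^ a)
          ≤ -laplacianFn (fun y => M * w y) x) ∧
      (∀ x, 0 < M * w x) ∧
      Tendsto (fun x => M * w x) (cocompact _) (nhds 0) := by
  refine ⟨exists_scale_of_sublinear hf_mono hf2' hw_pos hw_bdd, fun M hM hfM => ?_⟩
  have hM0 : 0 < M := one_pos.trans hM
  refine ⟨fun x => ?_, fun x => mul_pos hM0 (hw_pos x), by simpa using hw_lim.const_mul M⟩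
  rw [laplacianFn_const_mul hw_smooth,
    norm_gradient_const_mul (hw_smooth.differentiable (by norm_num) x), abs_of_pos hM0,
    Real.mul_rpow hM0.le (norm_nonneg _)]
  have hgM : g (M * w x) ≤ M * g (w x) :=
    (hg_dec.antitoneOn (hw_pos x) (mul_pos hM0 (hw_pos x))
      (le_mul_of_one_le_left (hw_pos x).le hM.le)).trans
      (le_mul_of_one_le_left (hg_pos _ (hw_pos x)).le hM.le)
  have hMa : M ^ a * ‖gradient w x‖ ^ a ≤ M * ‖gradient w x‖ ^ a :=
    mul_le_mul_of_nonneg_right (Real.rpow_le_self_of_one_le hM.le ha1.le) (by positivity)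
  calc p x * (g (M * w x) + f (M * w x) + M ^ a * ‖gradient w x‖ ^ a)
      ≤ p x * (M * g (w x) + M + M * ‖gradient w x‖ ^ a) :=
        mul_le_mul_of_nonneg_left (add_le_add (add_le_add hgM (hfM x).le) hMa) (hp_pos x).le
    _ = M * (p x * (g (w x) + 1 + ‖gradient w x‖ ^ a)) := by ring
    _ ≤ M * -laplacianFn w x := mul_le_mul_of_nonneg_left (hw_super x) hM0.le
    _ = -(M * laplacianFn w x) := mul_neg _ _
end

section
/- Let Ω ⊂ ℝ^N (N ≥ 3) be a smooth bounded domain, 0 < a < 1, let p : Ω̄ → (0,∞) be continuous, let g ∈ C¹(0,∞) be positive and decreasing with lim_{t→0+} g(t) = +∞, and let f satisfy (f1)–(f2). Let λ₁ > 0 and φ₁ ∈ C²(Ω̄) satisfy −Δφ₁ = λ₁ φ₁ in Ω, φ₁ > 0 in Ω, φ₁ = 0 on ∂Ω, and suppose there exist an open set ω compactly contained in Ω and δ > 0 such that |∇φ₁| > δ in Ω∖ω and φ₁ > δ in ω. Let η > 0 and let h : [0,η] → [0,∞) be continuous, C² on (0,η), increasing, with h''(t) = −g(h(t)) on (0,η),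 h(0) = 0, h > 0 on (0,η], and h' > 0 on (0,η]. Then for every c > 0 with c‖φ₁‖_∞ < η there exists M > 1 such that ū := M h(cφ₁) satisfies −Δū ≥ p(x)(g(ū) + f(ū) + |∇ū|^a) in Ω; that is, ū is a supersolution of the problem −Δu = p(x)(g(u) + f(u) + |∇u|^a) in Ω, u = 0 on ∂Ω. -/
open Filter Set MeasureTheory Bornology

/-- The derivative of a `C¹` function on the closure of a bounded open set is bounded on that
set. -/
lemma exists_norm_fderiv_le_of_contDiffOn_closure {E F : Type*} [NormedAddCommGroup E]
    [NormedSpace ℝ E] [ProperSpace E] [NormedAddCommGroup F] [NormedSpace ℝ F] {Ω : Set E}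
    (hΩ : IsOpen Ω) (hb : IsBounded Ω) {φ : E → F} (hφ : ContDiffOn ℝ 1 φ (closure Ω)) :
    ∃ B : ℝ, 0 ≤ B ∧ ∀ x ∈ Ω, ‖fderiv ℝ φ x‖ ≤ B := by
  have hc : IsCompact (closure Ω) := hb.isCompact_closure
  suffices hs : ∃ B : ℝ, ∀ x ∈ closure Ω, x ∈ Ω → ‖fderiv ℝ φ x‖ ≤ B by
    obtain ⟨B, hB⟩ := hs
    exact ⟨max B 0, le_max_right _ _, fun x hx =>
      (hB x (subset_closure hx) hx).trans (le_max_left _ _)⟩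
  refine hc.induction_on (p := fun s => ∃ B : ℝ, ∀ x ∈ s, x ∈ Ω → ‖fderiv ℝ φ x‖ ≤ B)
    ⟨0, by simp⟩ ?_ ?_ ?_
  · rintro s t hst ⟨B, hB⟩
    exact ⟨B, fun x hx => hB x (hst hx)⟩
  · rintro s t ⟨B, hB⟩ ⟨C, hC⟩
    refine ⟨max B C, ?_⟩
    rintro x (hx | hx) hxΩ
    · exact (hB x hx hxΩ).trans (le_max_left _ _)
    · exact (hC x hx hxΩ).trans (le_max_right _ _)
  · intro x hx
    obtain ⟨u, hu, -, -, f', hf', hcont⟩ :=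
      (contDiffWithinAt_succ_iff_hasFDerivWithinAt' (n := 0) (by simp)).1 (by simpa using hφ x hx)
    rw [insert_eq_of_mem hx] at hu
    refine ⟨_, Filter.inter_mem (hcont.continuousWithinAt.norm.eventually_lt_const (lt_add_one _))
      hu, ‖f' x‖ + 1, ?_⟩
    rintro y ⟨hy1, hy2⟩ hyΩ
    rw [((hf' y hy2).hasFDerivAt
      (Filter.mem_of_superset (hΩ.mem_nhds hyΩ) subset_closure)).fderiv]
    exact le_of_lt hy1

section Composition

variable {N : ℕ} {φ : EuclideanSpace ℝ (Fin N) → ℝ} {x : EuclideanSpace ℝ (Fin N)} {h : ℝ → ℝ}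

lemma hasFDerivAt_const_mul_comp_const_mul {d c M : ℝ} (hφ : DifferentiableAt ℝ φ x)
    (hh : HasDerivAt h d (c * φ x)) :
    HasFDerivAt (fun y => M * h (c * φ y)) ((M * c * d) • fderiv ℝ φ x) x := by
  have h1 : HasFDerivAt (fun y => c * φ y) (c • fderiv ℝ φ x) x := hφ.hasFDerivAt.const_mul c
  have h2 := (hh.comp_hasFDerivAt x h1).const_mul M
  rw [smul_smul, smul_smul, mul_right_comm] at h2
  exact h2

lemma norm_gradient_eq_norm_fderiv : ‖gradient φ x‖ = ‖fderiv ℝ φ x‖ := by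
  simp [gradient]

lemma sum_sq_fderiv_single_eq_norm_sq :
    ∑ i, (fderiv ℝ φ x (EuclideanSpace.single i 1)) ^ 2 = ‖gradient φ x‖ ^ 2 := by
  rw [EuclideanSpace.norm_sq_eq]
  refine Finset.sum_congr rfl fun i _ => ?_
  have : fderiv ℝ φ x (EuclideanSpace.single i 1) = gradient φ x i := by
    have h1 : inner ℝ (gradient φ x) (EuclideanSpace.single i (1 : ℝ))
        = fderiv ℝ φ x (EuclideanSpace.single i 1) := by
      simp [gradient]
    rw [← h1, EuclideanSpace.inner_single_right]
    simp
  rw [this]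
  simp

/-- Chain rule for the Laplacian of `M h(cφ)`. -/
lemma laplacianFn_const_mul_comp_const_mul {h' : ℝ → ℝ} {k c M : ℝ} (hφ : ContDiffAt ℝ 2 φ x)
    (hh : ∀ᶠ t in nhds (c * φ x), HasDerivAt h (h' t) t) (hh' : HasDerivAt h' k (c * φ x)) :
    laplacianFn (fun y => M * h (c * φ y)) x =
      M * (c ^ 2 * k * ‖gradient φ x‖ ^ 2 + c * h' (c * φ x) * laplacianFn φ x) := by
  have hev : ∀ᶠ y in nhds x, fderiv ℝ (fun y => M * h (c * φ y)) y =
      (M * c * h' (c * φ y)) • fderiv ℝ φ y := by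
    have h1 : ∀ᶠ y in nhds x, HasDerivAt h (h' (c * φ y)) (c * φ y) :=
      (hφ.continuousAt.const_mul c).eventually hh
    have h2 : ∀ᶠ y in nhds x, ContDiffAt ℝ 2 φ y := hφ.eventually (by simp)
    filter_upwards [h1, h2] with y hy1 hy2
    exact (hasFDerivAt_const_mul_comp_const_mul (hy2.differentiableAt (by simp)) hy1).fderiv
  have hd : DifferentiableAt ℝ (fderiv ℝ φ) x :=
    (hφ.fderiv_right (m := 1) (by norm_num)).differentiableAt (by simp)
  rw [← sum_sq_fderiv_single_eq_norm_sq]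
  unfold laplacianFn
  rw [mul_add, Finset.mul_sum, Finset.mul_sum, Finset.mul_sum, Finset.mul_sum,
    ← Finset.sum_add_distrib]
  refine Finset.sum_congr rfl fun i _ => ?_
  set e : EuclideanSpace ℝ (Fin N) := EuclideanSpace.single i 1
  have he : (fun y => fderiv ℝ (fun y => M * h (c * φ y)) y e) =ᶠ[nhds x]
      fun y => M * c * h' (c * φ y) * fderiv ℝ φ y e := by
    filter_upwards [hev] with y hy
    rw [hy]
    simp
  have hde : DifferentiableAt ℝ (fun y => fderiv ℝ φ y e) x := hd.clm_apply (by fun_prop)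
  have h3 : HasFDerivAt (fun y => M * c * h' (c * φ y)) ((M * c * c * k) • fderiv ℝ φ x) x :=
    hasFDerivAt_const_mul_comp_const_mul (M := M * c) (hφ.differentiableAt (by simp)) hh'
  rw [he.fderiv_eq, fderiv_fun_mul h3.differentiableAt hde, h3.fderiv]
  simp
  ring

end Composition

/-- If `h'' = -g(h)` with `g(h)` positive and decreasing, then `h'` is decreasing and grows at
most like `g(h)`. -/
lemma deriv_bounds_of_hasDerivAt_neg_comp {g h h' : ℝ → ℝ} {η : ℝ}
    (hg_pos : ∀ t > (0:ℝ), 0 < g t) (hg_dec : StrictAntiOn g (Ioi 0))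
    (h_pos : ∀ t ∈ Ioc 0 η, 0 < h t) (h_incr : StrictMonoOn h (Icc 0 η))
    (h''_eq : ∀ t ∈ Ioo 0 η, HasDerivAt h' (-(g (h t))) t)
    {s S : ℝ} (hs : 0 < s) (hsS : s ≤ S) (hS : S < η) :
    h' S ≤ h' s ∧ h' s ≤ h' S + η * g (h s) := by
  have hpos : ∀ t, 0 < t → t < η → 0 < g (h t) := fun t ht ht' =>
    hg_pos _ (h_pos t ⟨ht, ht'.le⟩)
  rcases hsS.eq_or_lt with rfl | hlt
  · exact ⟨le_rfl, le_add_of_nonneg_right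
      (mul_nonneg (hs.trans hS).le (hpos s hs hS).le)⟩
  obtain ⟨ξ, hξ, hξ'⟩ := exists_hasDerivAt_eq_slope h' (fun t => -(g (h t))) hlt
    (fun t ht => (h''_eq t ⟨hs.trans_le ht.1, ht.2.trans_lt hS⟩).continuousAt.continuousWithinAt)
    (fun t ht => h''_eq t ⟨hs.trans ht.1, ht.2.trans hS⟩)
  have hξ0 : 0 < ξ := hs.trans hξ.1
  have hξη : ξ < η := hξ.2.trans hS
  have hg1 : 0 < g (h ξ) := hpos ξ hξ0 hξη
  have hg2 : g (h ξ) ≤ g (h s) :=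
    (hg_dec (h_pos s ⟨hs, (hlt.trans hS).le⟩) (h_pos ξ ⟨hξ0, hξη.le⟩)
      (h_incr ⟨hs.le, (hlt.trans hS).le⟩ ⟨hξ0.le, hξη.le⟩ hξ.1)).le
  rw [eq_div_iff (sub_pos.2 hlt).ne'] at hξ'
  have hlen : S - s ≤ η := by linarith
  constructor
  · nlinarith [mul_pos hg1 (sub_pos.2 hlt)]
  · have : g (h ξ) * (S - s) ≤ g (h s) * η :=
      mul_le_mul hg2 hlen (sub_pos.2 hlt).le (hg1.le.trans hg2)
    linarith

lemma Real.rpow_le_self_add_one {t a : ℝ} (ht : 0 ≤ t) (ha0 : 0 ≤ a) (ha1 : a ≤ 1) :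
    t ^ a ≤ t + 1 := by
  rcases le_total t 1 with h | h
  · linarith [Real.rpow_le_one ht h ha0]
  · have := Real.rpow_le_rpow_of_exponent_le h ha1
    rw [Real.rpow_one] at this
    linarith

/-- Sublinear perturbations are dominated by a large multiple. -/
lemma exists_one_lt_sublinear_bounds {f : ℝ → ℝ} {a P C H ε ρ : ℝ} (ha1 : a < 1)
    (hf : Tendsto (fun t => f t / t) atTop (nhds 0)) (hH : 0 < H) (hε : 0 < ε) (hρ : 0 < ρ) :
    ∃ M : ℝ, 1 < M ∧ P ≤ M * ε ∧ P * f (M * H) ≤ M * ρ ∧ P * (C * M ^ a) ≤ M * ε := by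
  have e1 : ∀ᶠ M : ℝ in atTop, P ≤ M * ε :=
    (tendsto_id.atTop_mul_const hε).eventually_ge_atTop P
  have e2 : ∀ᶠ M : ℝ in atTop, P * f (M * H) ≤ M * ρ := by
    have t1 : Tendsto (fun M : ℝ => P * H * (f (M * H) / (M * H))) atTop (nhds (P * H * 0)) :=
      (hf.comp (tendsto_id.atTop_mul_const hH)).const_mul _
    rw [mul_zero] at t1
    filter_upwards [t1.eventually_lt_const hρ, eventually_gt_atTop 0] with M hM hM0
    have : P * f (M * H) = M * (P * H * (f (M * H) / (M * H))) := by field_simp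
    rw [this]
    gcongr
  have e3 : ∀ᶠ M : ℝ in atTop, P * (C * M ^ a) ≤ M * ε := by
    have t1 : Tendsto (fun M : ℝ => P * C * M ^ (-(1 - a))) atTop (nhds (P * C * 0)) :=
      (tendsto_rpow_neg_atTop (sub_pos.2 ha1)).const_mul _
    rw [mul_zero] at t1
    filter_upwards [t1.eventually_lt_const hε, eventually_gt_atTop 0] with M hM hM0
    have hMa : M ^ a = M * M ^ (-(1 - a)) := by
      nth_rw 2 [← Real.rpow_one M]
      rw [← Real.rpow_add hM0]
      ring_nf
    have : P * (C * M ^ a) = M * (P * C * M ^ (-(1 - a))) := by rw [hMa]; ring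
    rw [this]
    gcongr
  obtain ⟨M, h1, h2, h3, h4⟩ := ((eventually_gt_atTop 1).and (e1.and (e2.and e3))).exists
  exact ⟨M, h1, h2, h3, h4⟩

/-- if `(λ₁, φ₁)` is the principal Dirichlet eigenpair of `-Δ` on `Ω`,
with the Hopf-type sets `ω ⊂⊂ Ω` and `δ > 0` such that `|∇φ₁| > δ` on `Ω∖ω` and
`φ₁ > δ` on `ω`, and `h` solves `h'' = -g(h)` on `(0,η)` with `h(0) = 0`, `h, h' > 0`,
then for every `c > 0` with `c‖φ₁‖_∞ < η` there is `M > 1` such that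
`ū = M h(cφ₁)` is a supersolution: `-Δū ≥ p(x)(g(ū) + f(ū) + |∇ū|^a)` in `Ω`. -/
theorem supersolution_M_h_c_phi1
    {N : ℕ} (hN : 3 ≤ N)
    (Ω : Set (EuclideanSpace ℝ (Fin N)))
    (hΩ_open : IsOpen Ω) (hΩ_bdd : IsBounded Ω) (hΩ_conn : IsConnected Ω)
    (a : ℝ) (ha0 : 0 < a) (ha1 : a < 1)
    (p : EuclideanSpace ℝ (Fin N) → ℝ)
    (hp_cont : ContinuousOn p (closure Ω))
    (hp_pos : ∀ x ∈ closure Ω, 0 < p x)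
    (g : ℝ → ℝ)
    (hg_smooth : ContDiffOn ℝ 1 g (Ioi 0))
    (hg_pos : ∀ t > (0:ℝ), 0 < g t)
    (hg_dec : StrictAntiOn g (Ioi 0))
    (hg1 : Tendsto g (nhdsWithin 0 (Ioi 0)) atTop)
    (f : ℝ → ℝ)
    (hf_cont : ContinuousOn f (Ici 0))
    (hf_nonneg : ∀ t ≥ (0:ℝ), 0 ≤ f t)
    (hf_mono : MonotoneOn f (Ici 0))
    (hf_pos : ∀ t > (0:ℝ), 0 < f t)
    (hf1 : AntitoneOn (fun t => f t / t) (Ioi 0))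
    (hf2 : Tendsto (fun t => f t / t) (nhdsWithin 0 (Ioi 0)) atTop)
    (hf2' : Tendsto (fun t => f t / t) atTop (nhds 0))
    (lam1 : ℝ) (hlam1 : 0 < lam1)
    (φ1 : EuclideanSpace ℝ (Fin N) → ℝ)
    (hφ1_smooth : ContDiffOn ℝ 2 φ1 (closure Ω))
    (hφ1_eq : ∀ x ∈ Ω, -laplacianFn φ1 x = lam1 * φ1 x)
    (hφ1_pos : ∀ x ∈ Ω, 0 < φ1 x)
    (hφ1_bdry : ∀ x ∈ frontier Ω, φ1 x = 0)
    (ω : Set (EuclideanSpace ℝ (Fin N)))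
    (hω_open : IsOpen ω) (hω_sub : closure ω ⊆ Ω)
    (δ : ℝ) (hδ : 0 < δ)
    (hgrad : ∀ x ∈ Ω \ ω, δ < ‖gradient φ1 x‖)
    (hφ1δ : ∀ x ∈ ω, δ < φ1 x)
    (η : ℝ) (hη : 0 < η)
    (h h' : ℝ → ℝ)
    (h_cont : ContinuousOn h (Icc 0 η))
    (h_deriv : ∀ t ∈ Ioo 0 η, HasDerivAt h (h' t) t)
    (h_derivη : HasDerivWithinAt h (h' η) (Iic η) η)
    (h'_cont : ContinuousOn h' (Ioc 0 η))
    (h''_eq : ∀ t ∈ Ioo 0 η, HasDerivAt h' (-(g (h t))) t)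
    (h_zero : h 0 = 0)
    (h_pos : ∀ t ∈ Ioc 0 η, 0 < h t)
    (h'_pos : ∀ t ∈ Ioc 0 η, 0 < h' t)
    (h_incr : StrictMonoOn h (Icc 0 η)) :
    ∀ c > (0:ℝ), c * sSup ((fun x => |φ1 x|) '' closure Ω) < η →
      ∃ M : ℝ, 1 < M ∧
        ∀ x ∈ Ω,
          p x * (g (M * h (c * φ1 x)) + f (M * h (c * φ1 x)) +
              ‖gradient (fun y => M * h (c * φ1 y)) x‖ ^ a)
            ≤ -laplacianFn (fun y => M * h (c * φ1 y)) x := by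
  intro c hc hcη
  obtain ⟨x₀, hx₀⟩ := hΩ_conn.nonempty
  have hcl : IsCompact (closure Ω) := hΩ_bdd.isCompact_closure
  obtain ⟨B, hB0, hB⟩ := exists_norm_fderiv_le_of_contDiffOn_closure hΩ_open hΩ_bdd
    (hφ1_smooth.of_le (by norm_num))
  obtain ⟨P, hP⟩ := (hcl.image_of_continuousOn hp_cont).bddAbove
  have hpP : ∀ x ∈ Ω, p x ≤ P := fun x hx => hP (mem_image_of_mem p (subset_closure hx))
  have hP0 : 0 < P := (hp_pos x₀ (subset_closure hx₀)).trans_le (hpP x₀ hx₀)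
  set S := c * sSup ((fun x => |φ1 x|) '' closure Ω)
  have hφS : ∀ x ∈ Ω, c * φ1 x ≤ S := fun x hx =>
    mul_le_mul_of_nonneg_left ((le_abs_self _).trans
      (le_csSup (hcl.image_of_continuousOn hφ1_smooth.continuousOn.abs).bddAbove
        (mem_image_of_mem (fun x => |φ1 x|) (subset_closure hx)))) hc.le
  have hS0 : 0 < S := (mul_pos hc (hφ1_pos x₀ hx₀)).trans_le (hφS x₀ hx₀)
  have hs0 : ∀ x ∈ Ω, 0 < c * φ1 x := fun x hx => mul_pos hc (hφ1_pos x hx)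
  have h_le : ∀ s t, 0 < s → s ≤ t → t < η → h s ≤ h t := fun s t hs hst ht =>
    h_incr.monotoneOn ⟨hs.le, (hst.trans_lt ht).le⟩ ⟨(hs.trans_le hst).le, ht.le⟩ hst
  have hhpos : ∀ s, 0 < s → s < η → 0 < h s := fun s h1 h2 => h_pos s ⟨h1, h2.le⟩
  have hgle : ∀ s t, 0 < s → s ≤ t → t < η → g (h t) ≤ g (h s) := fun s t hs hst ht =>
    hg_dec.antitoneOn (hhpos s hs (hst.trans_lt ht)) (hhpos t (hs.trans_le hst) ht)
      (h_le s t hs hst ht)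
  have hh'S : 0 < h' S := h'_pos S ⟨hS0, hcη.le⟩
  have hbd : ∀ s, 0 < s → s ≤ S → h' S ≤ h' s ∧ h' s ≤ h' S + η * g (h s) := fun s hs hsS =>
    deriv_bounds_of_hasDerivAt_neg_comp hg_pos hg_dec h_pos h_incr h''_eq hs hsS hcη
  set γ := g (h S)
  have hγ0 : 0 < γ := hg_pos _ (hhpos S hS0 hcη)
  obtain ⟨κ, hκ0, hκ⟩ : ∃ κ > 0, ∀ x ∈ Ω, κ * g (h (c * φ1 x)) ≤
      c ^ 2 * g (h (c * φ1 x)) * ‖gradient φ1 x‖ ^ 2 +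
        c * h' (c * φ1 x) * (lam1 * φ1 x) := by
    set m := min (c * δ) S
    have hm0 : 0 < m := lt_min (mul_pos hc hδ) hS0
    have hgm : 0 < g (h m) := hg_pos _ (hhpos m hm0 ((min_le_right _ _).trans_lt hcη))
    refine ⟨min (c ^ 2 * δ ^ 2) (c * h' S * (lam1 * δ) / g (h m)), by positivity, ?_⟩
    intro x hx
    have hs := hs0 x hx
    have hsS := hφS x hx
    have hgs : 0 < g (h (c * φ1 x)) := hg_pos _ (hhpos _ hs (hsS.trans_lt hcη))
    have hh's : 0 < h' (c * φ1 x) := hh'S.trans_le (hbd _ hs hsS).1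
    have hφx := hφ1_pos x hx
    by_cases hxω : x ∈ ω
    · have hδx := hφ1δ x hxω
      have hg' : g (h (c * φ1 x)) ≤ g (h m) :=
        hgle m _ hm0 ((min_le_left _ _).trans (by gcongr)) (hsS.trans_lt hcη)
      calc _ ≤ c * h' S * (lam1 * δ) / g (h m) * g (h m) := by
            gcongr
            exact min_le_right _ _
        _ = c * h' S * (lam1 * δ) := by field_simp
        _ ≤ c * h' (c * φ1 x) * (lam1 * φ1 x) := by
            gcongr
            exact (hbd _ hs hsS).1
        _ ≤ _ := le_add_of_nonneg_left (by positivity)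
    · have hδx := hgrad x ⟨hx, hxω⟩
      calc _ ≤ c ^ 2 * δ ^ 2 * g (h (c * φ1 x)) := by
            gcongr
            exact min_le_left _ _
        _ = c ^ 2 * g (h (c * φ1 x)) * δ ^ 2 := by ring
        _ ≤ c ^ 2 * g (h (c * φ1 x)) * ‖gradient φ1 x‖ ^ 2 := by gcongr
        _ ≤ _ := le_add_of_nonneg_right (by positivity)
  set K := (c * B * h' S + 1) / γ + c * B * η with hK
  obtain ⟨M, hM1, hMg, hMf, hMa⟩ := exists_one_lt_sublinear_bounds (P := P) (C := K) ha1 hf2'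
    (hhpos S hS0 hcη) (show 0 < κ / 3 by positivity) (show 0 < κ / 3 * γ by positivity)
  have hM0 : 0 < M := one_pos.trans hM1
  refine ⟨M, hM1, fun x hx => ?_⟩
  have hs := hs0 x hx
  have hsS := hφS x hx
  have hsη := hsS.trans_lt hcη
  have hφx : ContDiffAt ℝ 2 φ1 x :=
    hφ1_smooth.contDiffAt (Filter.mem_of_superset (hΩ_open.mem_nhds hx) subset_closure)
  have hgrad_eq : ‖gradient (fun y => M * h (c * φ1 y)) x‖ =
      M * (c * ‖fderiv ℝ φ1 x‖ * h' (c * φ1 x)) := by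
    rw [norm_gradient_eq_norm_fderiv, (hasFDerivAt_const_mul_comp_const_mul
      (hφx.differentiableAt (by simp)) (h_deriv _ ⟨hs, hsη⟩)).fderiv, norm_smul,
      Real.norm_of_nonneg (by have := h'_pos _ ⟨hs, hsη.le⟩; positivity)]
    ring
  have hlap : -laplacianFn (fun y => M * h (c * φ1 y)) x =
      M * (c ^ 2 * g (h (c * φ1 x)) * ‖gradient φ1 x‖ ^ 2 +
        c * h' (c * φ1 x) * (lam1 * φ1 x)) := by
    rw [laplacianFn_const_mul_comp_const_mul hφx
      (Filter.mem_of_superset (Ioo_mem_nhds hs hsη) h_deriv) (h''_eq _ ⟨hs, hsη⟩),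
      ← hφ1_eq x hx]
    ring
  rw [hlap, hgrad_eq]
  have hκx := hκ x hx
  have hbx := hbd _ hs hsS
  have hγx : γ ≤ g (h (c * φ1 x)) := hgle _ _ hs hsS hcη
  have hhx := hhpos _ hs hsη
  have hh'x := h'_pos _ ⟨hs, hsη.le⟩
  have hhS : h (c * φ1 x) ≤ h S := h_le _ _ hs hsS hcη
  have hBx := hB x hx
  set G := g (h (c * φ1 x))
  have hG0 : 0 < G := hγ0.trans_le hγx
  set d := h' (c * φ1 x)
  have hsing : g (M * h (c * φ1 x)) ≤ G :=
    hg_dec.antitoneOn hhx (mul_pos hM0 hhx) (le_mul_of_one_le_left hhx.le hM1.le)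
  have hsub : f (M * h (c * φ1 x)) ≤ f (M * h S) :=
    hf_mono (mul_pos hM0 hhx).le (mul_pos hM0 (hhx.trans_le hhS)).le (by gcongr)
  have hconv : (M * (c * ‖fderiv ℝ φ1 x‖ * d)) ^ a ≤ K * M ^ a * G := by
    rw [Real.mul_rpow hM0.le (by positivity)]
    have h1 : (c * ‖fderiv ℝ φ1 x‖ * d) ^ a ≤ K * G :=
      calc _ ≤ c * ‖fderiv ℝ φ1 x‖ * d + 1 :=
            Real.rpow_le_self_add_one (by positivity) ha0.le ha1.le
        _ ≤ c * B * (h' S + η * G) + 1 := by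
            gcongr
            exact hbx.2
        _ = (c * B * h' S + 1) / γ * γ + c * B * η * G := by
            field_simp
            ring
        _ ≤ (c * B * h' S + 1) / γ * G + c * B * η * G := by gcongr
        _ = K * G := by rw [hK]; ring
    calc _ ≤ M ^ a * (K * G) := by gcongr
      _ = _ := by ring
  have hfM : 0 ≤ f (M * h (c * φ1 x)) := hf_nonneg _ (mul_pos hM0 hhx).le
  have hgM : 0 < g (M * h (c * φ1 x)) := hg_pos _ (mul_pos hM0 hhx)
  calc _ ≤ P * (G + f (M * h S) + K * M ^ a * G) := by
        gcongr
        exact hpP x hx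
    _ = P * G + P * f (M * h S) + P * (K * M ^ a) * G := by ring
    _ ≤ M * (κ / 3) * G + M * (κ / 3 * G) + M * (κ / 3) * G := by
        refine add_le_add (add_le_add (by gcongr) (hMf.trans (by gcongr))) (by gcongr)
    _ = M * (κ * G) := by ring
    _ ≤ _ := by gcongr
end
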